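/- Let n ≥ 4 and p = p_c(n), and suppose the initial data are nonnegative with at least one positive somewhere. Then there is a constant C > 0 such that for all sufficiently large t < T, ∫_{ℝⁿ} |u(x,t)|^p dx ≥ C (t − R)^{n−1−(n−1)p/2} ln((t − R)/2). Consequently F₀''(t) ≥ C (t − R)^{n−1−(n−1)p/2} ln((t − R)/2), and for large t, F₀(t) ≥ C (t − R)^{n+1−(n−1)p/2} ln t. -/

import Mathlib

open MeasureTheory Metric Set ENNReal Filter

noncomputable section

/-- The Laplacian of `f : ℝⁿ → ℝ`, as the sum of the second derivatives along the
coordinate directions. -/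
def lap (n : ℕ) (f : EuclideanSpace ℝ (Fin n) → ℝ) (x : EuclideanSpace ℝ (Fin n)) : ℝ :=
  ∑ i : Fin n, iteratedDeriv 2 (fun s : ℝ => f (x + s • EuclideanSpace.single i (1 : ℝ))) 0

/-- The time interval `[0, T)`, where `T : ℝ≥0∞` may be infinite. -/
def timeSet (T : ℝ≥0∞) : Set ℝ := {t : ℝ | 0 ≤ t ∧ ENNReal.ofReal t < T}

namespace CriticalWave

section ConeFields

variable {E : Type*} [NormedAddCommGroup E] {R : ℝ} {G G' H : ℝ → E → ℝ}

/-- A field `G s x`, jointly continuous for `s > 0` and supported in the cone `‖x‖ ≤ s + R`. -/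
structure IsConeField (R : ℝ) (G : ℝ → E → ℝ) : Prop where
  continuousOn : ContinuousOn (Function.uncurry G) (Ioi 0 ×ˢ univ)
  eq_zero : ∀ s, 0 < s → ∀ x, s + R < ‖x‖ → G s x = 0

namespace IsConeField

lemma add (hG : IsConeField R G) (hH : IsConeField R H) :
    IsConeField R (fun s x => G s x + H s x) :=
  ⟨hG.1.add hH.1, fun s hs x hx => by simp [hG.2 s hs x hx, hH.2 s hs x hx]⟩

lemma sub (hG : IsConeField R G) (hH : IsConeField R H) :
    IsConeField R (fun s x => G s x - H s x) :=
  ⟨hG.1.sub hH.1, fun s hs x hx => by simp [hG.2 s hs x hx, hH.2 s hs x hx]⟩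

lemma mul_of_continuousOn (hG : IsConeField R G)
    (hH : ContinuousOn (Function.uncurry H) (Ioi 0 ×ˢ univ)) :
    IsConeField R (fun s x => G s x * H s x) :=
  ⟨hG.1.mul hH, fun s hs x hx => by simp [hG.2 s hs x hx]⟩

lemma mul (hG : IsConeField R G) (hH : IsConeField R H) :
    IsConeField R (fun s x => G s x * H s x) :=
  hG.mul_of_continuousOn hH.1

lemma const_mul (c : ℝ) (hG : IsConeField R G) : IsConeField R (fun s x => c * G s x) :=
  ⟨continuousOn_const.mul hG.1, fun s hs x hx => by simp [hG.2 s hs x hx]⟩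

lemma sum {ι : Type*} (t : Finset ι) {F : ι → ℝ → E → ℝ} (hF : ∀ i ∈ t, IsConeField R (F i)) :
    IsConeField R (fun s x => ∑ i ∈ t, F i s x) where
  continuousOn := by
    have : ContinuousOn (fun q : ℝ × E => ∑ i ∈ t, F i q.1 q.2) (Ioi 0 ×ˢ univ) :=
      continuousOn_finsetSum t fun i hi => (hF i hi).1
    exact this
  eq_zero s hs x hx := Finset.sum_eq_zero fun i hi => (hF i hi).2 s hs x hx

lemma abs_rpow {p : ℝ} (hp : 0 < p) (hG : IsConeField R G) :
    IsConeField R (fun s x => |G s x| ^ p) :=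
  ⟨hG.1.abs.rpow_const fun _ _ => Or.inr hp.le,
    fun s hs x hx => by simp [hG.2 s hs x hx, Real.zero_rpow hp.ne']⟩

lemma continuous_slice (hG : IsConeField R G) {s : ℝ} (hs : 0 < s) : Continuous (G s) :=
  hG.1.comp_continuous (f := fun x : E => (s, x)) (by fun_prop) fun x => by simp [hs]

lemma hasCompactSupport [ProperSpace E] (hG : IsConeField R G) {s : ℝ} (hs : 0 < s) :
    HasCompactSupport (G s) :=
  HasCompactSupport.intro (isCompact_closedBall (0 : E) (s + R)) fun x hx =>
    hG.2 s hs x (by simpa using hx)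

variable [NormedSpace ℝ E] [FiniteDimensional ℝ E] [MeasurableSpace E] [BorelSpace E]
  {μ : Measure E} [IsFiniteMeasureOnCompacts μ]

lemma integrable (hG : IsConeField R G) {s : ℝ} (hs : 0 < s) : Integrable (G s) μ :=
  have := FiniteDimensional.proper_real E
  (hG.continuous_slice hs).integrable_of_hasCompactSupport (hG.hasCompactSupport hs)

lemma continuousOn_integral (hG : IsConeField R G) :
    ContinuousOn (fun s => ∫ x, G s x ∂μ) (Ioi 0) := by
  have := FiniteDimensional.proper_real E
  intro s hs
  have hs' : (0 : ℝ) < s := hs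
  have h := continuousOn_integral_of_compact_support (μ := μ) (f := G) (s := Ioo 0 (s + 1))
    (isCompact_closedBall (0 : E) (s + 1 + R))
    (hG.1.mono (prod_mono (fun r hr => hr.1) subset_rfl))
    (fun r x hr hx => hG.2 r hr.1 x (by
      have : s + 1 + R < ‖x‖ := by simpa using hx
      linarith [hr.2]))
  exact (h.continuousAt (Ioo_mem_nhds hs' (by linarith))).continuousWithinAt

lemma hasDerivAt_integral (hG : IsConeField R G) (hG' : IsConeField R G')
    (hd : ∀ s, 0 < s → ∀ x, HasDerivAt (fun r => G r x) (G' s x) s) {s : ℝ} (hs : 0 < s) :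
    HasDerivAt (fun r => ∫ x, G r x ∂μ) (∫ x, G' s x ∂μ) s := by
  have := FiniteDimensional.proper_real E
  set K : Set (ℝ × E) := Icc (s / 2) (s + 1) ×ˢ closedBall (0 : E) (s + 1 + R) with hK
  have hKc : IsCompact K := isCompact_Icc.prod (isCompact_closedBall _ _)
  obtain ⟨C, hC⟩ := hKc.exists_bound_of_continuousOn (f := Function.uncurry G')
    (hG'.1.mono (prod_mono (fun r hr => lt_of_lt_of_le (by simpa using hs) hr.1)
      (subset_univ _)))
  have hmem : Ioo (s / 2) (s + 1) ∈ nhds s := Ioo_mem_nhds (by linarith) (by linarith)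
  refine (hasDerivAt_integral_of_dominated_loc_of_deriv_le
    (bound := (closedBall (0 : E) (s + 1 + R)).indicator fun _ => C) hmem ?_
    (hG.integrable hs) ?_ ?_ ?_ ?_).2
  · filter_upwards [hmem] with r hr
    exact (hG.continuous_slice (by linarith [hr.1])).aestronglyMeasurable
  · exact (hG'.continuous_slice hs).aestronglyMeasurable
  · refine Eventually.of_forall fun x r hr => ?_
    by_cases hx : x ∈ closedBall (0 : E) (s + 1 + R)
    · rw [indicator_of_mem hx]
      exact hC (r, x) ⟨⟨hr.1.le, hr.2.le⟩, hx⟩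
    · rw [indicator_of_notMem hx]
      have : s + 1 + R < ‖x‖ := by simpa using hx
      rw [hG'.2 r (by linarith [hr.1]) x (by linarith [hr.2]), norm_zero]
  · exact (integrable_indicator_iff measurableSet_closedBall).2
      (integrableOn_const (isCompact_closedBall _ _).measure_ne_top)
  · exact Eventually.of_forall fun x r hr => hd r (by linarith [hr.1]) x

end IsConeField

end ConeFields

section Derivatives

section

variable {E : Type*} [NormedAddCommGroup E] {u : E → ℝ → ℝ} {R : ℝ}

lemma continuousOn_swap {F : E × ℝ → ℝ} (hF : ContinuousOn F (univ ×ˢ Ioi 0)) :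
    ContinuousOn (Function.uncurry fun s x => F (x, s)) (Ioi 0 ×ˢ univ) :=
  hF.comp (f := Prod.swap) continuous_swap.continuousOn fun _ hq => ⟨mem_univ _, hq.1⟩

lemma isOpen_upper : IsOpen ((univ : Set E) ×ˢ Ioi (0 : ℝ)) := isOpen_univ.prod isOpen_Ioi

lemma upper_mem_nhds {s : ℝ} (hs : 0 < s) (x : E) :
    (univ : Set E) ×ˢ Ioi (0 : ℝ) ∈ nhds (x, s) :=
  isOpen_upper.mem_nhds ⟨mem_univ x, hs⟩

lemma eventually_zero (hsupp : ∀ s, 0 < s → ∀ x, s + R < ‖x‖ → u x s = 0) {s : ℝ}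
    (hs : 0 < s) {x : E} (hx : s + R < ‖x‖) :
    (fun q : E × ℝ => u q.1 q.2) =ᶠ[nhds (x, s)] fun _ => 0 := by
  have ho : IsOpen {q : E × ℝ | 0 < q.2 ∧ q.2 + R < ‖q.1‖} :=
    (isOpen_lt continuous_const continuous_snd).inter
      (isOpen_lt (continuous_snd.add continuous_const) continuous_fst.norm)
  filter_upwards [ho.mem_nhds ⟨hs, hx⟩] with q hq
  exact hsupp _ hq.1 _ hq.2

end

variable {E : Type*} [NormedAddCommGroup E] [NormedSpace ℝ E]

/-- The derivative of `(x, s) ↦ u x s` along `v`. -/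
def D (u : E → ℝ → ℝ) (v : E × ℝ) (s : ℝ) (x : E) : ℝ :=
  fderiv ℝ (fun q : E × ℝ => u q.1 q.2) (x, s) v

/-- The second derivative of `(x, s) ↦ u x s` along `v`, then along `w`. -/
def DD (u : E → ℝ → ℝ) (v w : E × ℝ) (s : ℝ) (x : E) : ℝ :=
  fderiv ℝ (fun q : E × ℝ => fderiv ℝ (fun q : E × ℝ => u q.1 q.2) q v) (x, s) w

variable {u : E → ℝ → ℝ} {R : ℝ}

section

variable (hU : ContDiffOn ℝ 2 (fun q : E × ℝ => u q.1 q.2) (univ ×ˢ Ioi 0))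
include hU

lemma differentiableAt_field {s : ℝ} (hs : 0 < s) (x : E) :
    DifferentiableAt ℝ (fun q : E × ℝ => u q.1 q.2) (x, s) :=
  (hU.contDiffAt (upper_mem_nhds hs x)).differentiableAt (by norm_num)

lemma contDiffOn_fderiv_apply (v : E × ℝ) :
    ContDiffOn ℝ 1 (fun q : E × ℝ => fderiv ℝ (fun q : E × ℝ => u q.1 q.2) q v)
      (univ ×ˢ Ioi 0) :=
  (hU.fderiv_of_isOpen isOpen_upper (m := 1) (by norm_num)).clm_apply contDiffOn_const

lemma differentiableAt_D (v : E × ℝ) {s : ℝ} (hs : 0 < s) (x : E) :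
    DifferentiableAt ℝ (fun q : E × ℝ => fderiv ℝ (fun q : E × ℝ => u q.1 q.2) q v) (x, s) :=
  ((contDiffOn_fderiv_apply hU v).contDiffAt
    (upper_mem_nhds hs x)).differentiableAt (by norm_num)

lemma DD_comm (v w : E × ℝ) {s : ℝ} (hs : 0 < s) (x : E) : DD u v w s x = DD u w v s x := by
  have hc := hU.contDiffAt (upper_mem_nhds hs x)
  have hd : DifferentiableAt ℝ (fderiv ℝ (fun q : E × ℝ => u q.1 q.2)) (x, s) :=
    (hc.fderiv_right (m := 1) (by norm_num)).differentiableAt (by norm_num)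
  have key : ∀ a b : E × ℝ,
      DD u a b s x = fderiv ℝ (fderiv ℝ (fun q : E × ℝ => u q.1 q.2)) (x, s) b a := by
    intro a b
    have := (hd.hasFDerivAt.clm_apply (hasFDerivAt_const a (x, s))).fderiv
    simp [DD, this]
  rw [key, key]
  exact (hc.isSymmSndFDerivAt (by simp)) w v

lemma hasDerivAt_time {s : ℝ} (hs : 0 < s) (x : E) :
    HasDerivAt (fun r => u x r) (D u (0, 1) s x) s :=
  (differentiableAt_field hU hs x).hasFDerivAt.comp_hasDerivAt s
    ((hasDerivAt_const s x).prodMk (hasDerivAt_id s))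

lemma hasDerivAt_D_time (v : E × ℝ) {s : ℝ} (hs : 0 < s) (x : E) :
    HasDerivAt (fun r => D u v r x) (DD u v (0, 1) s x) s :=
  (differentiableAt_D hU v hs x).hasFDerivAt.comp_hasDerivAt (f := fun r => (x, r)) s
    ((hasDerivAt_const s x).prodMk (hasDerivAt_id s))

lemma hasDerivAt_line (y : E) {s : ℝ} (hs : 0 < s) (x : E) (r : ℝ) :
    HasDerivAt (fun r : ℝ => u (x + r • y) s) (D u (y, 0) s (x + r • y)) r := by
  have h1 : HasDerivAt (fun r : ℝ => x + r • y) y r := by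
    simpa using ((hasDerivAt_id r).smul_const y).const_add x
  exact (differentiableAt_field hU hs (x + r • y)).hasFDerivAt.comp_hasDerivAt
    (f := fun r : ℝ => (x + r • y, s)) r (h1.prodMk (hasDerivAt_const r s))

lemma hasDerivAt_D_line (v : E × ℝ) (y : E) {s : ℝ} (hs : 0 < s) (x : E) (r : ℝ) :
    HasDerivAt (fun r : ℝ => D u v s (x + r • y)) (DD u v (y, 0) s (x + r • y)) r := by
  have h1 : HasDerivAt (fun r : ℝ => x + r • y) y r := by
    simpa using ((hasDerivAt_id r).smul_const y).const_add x
  exact (differentiableAt_D hU v hs (x + r • y)).hasFDerivAt.comp_hasDerivAt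
    (f := fun r : ℝ => (x + r • y, s)) r (h1.prodMk (hasDerivAt_const r s))

variable (hsupp : ∀ s, 0 < s → ∀ x, s + R < ‖x‖ → u x s = 0)
include hsupp

lemma isConeField_self : IsConeField R (fun s x => u x s) :=
  ⟨continuousOn_swap hU.continuousOn, hsupp⟩

lemma isConeField_D (v : E × ℝ) : IsConeField R (D u v) where
  continuousOn := continuousOn_swap (contDiffOn_fderiv_apply hU v).continuousOn
  eq_zero s hs x hx := by
    simp [D, (eventually_zero hsupp hs hx).fderiv_eq]

lemma isConeField_DD (v w : E × ℝ) : IsConeField R (DD u v w) where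
  continuousOn := by
    refine continuousOn_swap (F := fun q => fderiv ℝ (fun q : E × ℝ =>
      fderiv ℝ (fun q : E × ℝ => u q.1 q.2) q v) q w) ?_
    exact ((contDiffOn_fderiv_apply hU v).continuousOn_fderiv_of_isOpen isOpen_upper
      le_rfl).clm_apply continuousOn_const
  eq_zero s hs x hx := by
    have h : (fun q : E × ℝ => fderiv ℝ (fun q : E × ℝ => u q.1 q.2) q v)
        =ᶠ[nhds (x, s)] fun _ => 0 := by
      filter_upwards [(eventually_zero hsupp hs hx).fderiv (𝕜 := ℝ)] with q hq
      simp [hq]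
    simp [DD, h.fderiv_eq]

end

end Derivatives

section PlaneWaves

lemma integral_mul_lineDeriv {E : Type*} [NormedAddCommGroup E] [NormedSpace ℝ E]
    [FiniteDimensional ℝ E] [MeasurableSpace E] [BorelSpace E] {μ : Measure E}
    [μ.IsAddHaarMeasure] {a a' b b' : E → ℝ} {v : E}
    (ha : Continuous a) (ha' : Continuous a') (hb : Continuous b) (hb' : Continuous b')
    (hac : HasCompactSupport a) (ha'c : HasCompactSupport a')
    (hda : ∀ x, HasLineDerivAt ℝ a (a' x) x v) (hdb : ∀ x, HasLineDerivAt ℝ b (b' x) x v) :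
    ∫ x, a x * b' x ∂μ = -∫ x, a' x * b x ∂μ :=
  integral_bilinear_hasLineDerivAt_right_eq_neg_left_of_integrable
    (B := ContinuousLinearMap.mul ℝ ℝ)
    ((ha'.mul hb).integrable_of_hasCompactSupport ha'c.mul_right)
    ((ha.mul hb').integrable_of_hasCompactSupport hac.mul_right)
    ((ha.mul hb).integrable_of_hasCompactSupport hac.mul_right)
    (fun x _ => hda x) (fun x _ => hdb x)

variable {n : ℕ} {p R : ℝ} {u : EuclideanSpace ℝ (Fin n) → ℝ → ℝ}

/-- The `i`-th coordinate direction in space-time. -/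
abbrev dir (i : Fin n) : EuclideanSpace ℝ (Fin n) × ℝ := (EuclideanSpace.single i 1, 0)

/-- A `C²` solution of `∂ₜ²u = Δu + |u|^p` for positive times, supported in `‖x‖ ≤ s + R`. -/
structure IsSolution (n : ℕ) (p R : ℝ) (u : EuclideanSpace ℝ (Fin n) → ℝ → ℝ) : Prop where
  contDiffOn : ContDiffOn ℝ 2 (fun q : EuclideanSpace ℝ (Fin n) × ℝ => u q.1 q.2)
    (univ ×ˢ Ioi 0)
  supp : ∀ s, 0 < s → ∀ x, s + R < ‖x‖ → u x s = 0
  pde : ∀ s, 0 < s → ∀ x,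
    DD u (0, 1) (0, 1) s x = ∑ i, DD u (dir i) (dir i) s x + |u x s| ^ p

lemma lap_eq_sum_DD
    (hU : ContDiffOn ℝ 2 (fun q : EuclideanSpace ℝ (Fin n) × ℝ => u q.1 q.2) (univ ×ˢ Ioi 0))
    {s : ℝ} (hs : 0 < s) (x : EuclideanSpace ℝ (Fin n)) :
    lap n (fun y => u y s) x = ∑ i, DD u (dir i) (dir i) s x := by
  refine Finset.sum_congr rfl fun i _ => ?_
  have h : deriv (fun r : ℝ => u (x + r • EuclideanSpace.single i (1 : ℝ)) s)
      = fun r => D u (dir i) s (x + r • EuclideanSpace.single i (1 : ℝ)) :=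
    funext fun r => (hasDerivAt_line hU _ hs x r).deriv
  rw [iteratedDeriv_succ, iteratedDeriv_one, h, (hasDerivAt_D_line hU _ _ hs x 0).deriv]
  simp

lemma iteratedDeriv_time_eq_DD
    (hU : ContDiffOn ℝ 2 (fun q : EuclideanSpace ℝ (Fin n) × ℝ => u q.1 q.2) (univ ×ˢ Ioi 0))
    {s : ℝ} (hs : 0 < s) (x : EuclideanSpace ℝ (Fin n)) :
    iteratedDeriv 2 (u x) s = DD u (0, 1) (0, 1) s x := by
  have h : deriv (u x) =ᶠ[nhds s] fun r => D u (0, 1) r x := by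
    filter_upwards [Ioi_mem_nhds hs] with r hr
    exact (hasDerivAt_time hU hr x).deriv
  rw [iteratedDeriv_succ, iteratedDeriv_one, h.deriv_eq, (hasDerivAt_D_time hU _ hs x).deriv]

lemma hasLineDerivAt_planeWave {f f' : ℝ → ℝ} (hf : ∀ y, HasDerivAt f (f' y) y)
    (ω : EuclideanSpace ℝ (Fin n)) (c : ℝ) (i : Fin n) (x : EuclideanSpace ℝ (Fin n)) :
    HasLineDerivAt ℝ (fun x => f (inner ℝ x ω + c)) (f' (inner ℝ x ω + c) * ω i) x
      (EuclideanSpace.single i 1) := by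
  have h1 : HasDerivAt
      (fun r : ℝ => inner ℝ (x + r • EuclideanSpace.single i (1 : ℝ)) ω + c) (ω i) 0 := by
    have : (fun r : ℝ => inner ℝ (x + r • EuclideanSpace.single i (1 : ℝ)) ω + c)
        = fun r : ℝ => inner ℝ x ω + r * ω i + c := by
      funext r
      simp [inner_add_left, inner_smul_left, EuclideanSpace.inner_single_left]
    rw [this]
    simpa using (((hasDerivAt_id (0 : ℝ)).mul_const (ω i)).const_add (inner ℝ x ω)).add_const c
  have h2 : HasDerivAt f (f' (inner ℝ x ω + c))
      (inner ℝ (x + (0 : ℝ) • EuclideanSpace.single i (1 : ℝ)) ω + c) := by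
    simpa using hf (inner ℝ x ω + c)
  exact h2.comp (0 : ℝ) h1

namespace IsSolution

variable (h : IsSolution n p R u)
include h

lemma field : IsConeField R (fun s x => u x s) := isConeField_self h.contDiffOn h.supp

lemma field_D (v : EuclideanSpace ℝ (Fin n) × ℝ) : IsConeField R (D u v) :=
  isConeField_D h.contDiffOn h.supp v

lemma field_DD (v w : EuclideanSpace ℝ (Fin n) × ℝ) : IsConeField R (DD u v w) :=
  isConeField_DD h.contDiffOn h.supp v w

lemma integral_laplacian_mul_planeWave {f f' f'' : ℝ → ℝ} (hf : ∀ y, HasDerivAt f (f' y) y)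
    (hf' : ∀ y, HasDerivAt f' (f'' y) y) (hf'' : Continuous f'')
    {ω : EuclideanSpace ℝ (Fin n)} (hω : ‖ω‖ = 1) (c : ℝ) {s : ℝ} (hs : 0 < s) :
    ∫ x, (∑ i, DD u (dir i) (dir i) s x) * f (inner ℝ x ω + c)
      = ∫ x, u x s * f'' (inner ℝ x ω + c) := by
  have cf : Continuous f := continuous_iff_continuousAt.2 fun y => (hf y).continuousAt
  have cf' : Continuous f' := continuous_iff_continuousAt.2 fun y => (hf' y).continuousAt
  have key : ∀ i : Fin n, ∫ x, DD u (dir i) (dir i) s x * f (inner ℝ x ω + c)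
      = ∫ x, u x s * (f'' (inner ℝ x ω + c) * (ω i) ^ 2) := by
    intro i
    have e1 := integral_mul_lineDeriv (μ := volume) (v := EuclideanSpace.single i (1 : ℝ))
      (a := D u (dir i) s) (a' := DD u (dir i) (dir i) s)
      (b := fun x => f (inner ℝ x ω + c)) (b' := fun x => f' (inner ℝ x ω + c) * ω i)
      ((h.field_D _).continuous_slice hs) ((h.field_DD _ _).continuous_slice hs)
      (by fun_prop) (by fun_prop) ((h.field_D _).hasCompactSupport hs)
      ((h.field_DD _ _).hasCompactSupport hs)
      (fun x => by
        have := hasDerivAt_D_line h.contDiffOn (dir i) (EuclideanSpace.single i (1 : ℝ)) hs x 0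
        rwa [zero_smul, add_zero] at this)
      (fun x => hasLineDerivAt_planeWave hf ω c i x)
    have e2 := integral_mul_lineDeriv (μ := volume) (v := EuclideanSpace.single i (1 : ℝ))
      (a := fun x => u x s) (a' := D u (dir i) s)
      (b := fun x => f' (inner ℝ x ω + c) * ω i)
      (b' := fun x => f'' (inner ℝ x ω + c) * ω i * ω i)
      (h.field.continuous_slice hs) ((h.field_D _).continuous_slice hs)
      (by fun_prop) (by fun_prop) (h.field.hasCompactSupport hs)
      ((h.field_D _).hasCompactSupport hs)
      (fun x => by
        have := hasDerivAt_line h.contDiffOn (EuclideanSpace.single i (1 : ℝ)) hs x 0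
        rwa [zero_smul, add_zero] at this)
      (fun x => by
        have := HasDerivAt.mul_const (hasLineDerivAt_planeWave hf' ω c i x) (ω i)
        exact this)
    rw [← neg_eq_iff_eq_neg] at e1
    rw [← e1, ← e2]
    refine integral_congr_ae (Eventually.of_forall fun x => ?_)
    simp only
    ring
  have hi : ∀ i ∈ Finset.univ, Integrable
      (fun x => DD u (dir i) (dir i) s x * f (inner ℝ x ω + c)) := fun i _ =>
    (((h.field_DD (dir i) (dir i)).continuous_slice hs).mul
      (by fun_prop)).integrable_of_hasCompactSupport
      ((h.field_DD _ _).hasCompactSupport hs).mul_right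
  have hj : ∀ i ∈ Finset.univ, Integrable
      (fun x => u x s * (f'' (inner ℝ x ω + c) * (ω i) ^ 2)) := fun i _ =>
    ((h.field.continuous_slice hs).mul (by fun_prop)).integrable_of_hasCompactSupport
      (h.field.hasCompactSupport hs).mul_right
  have hω2 : ∑ i, (ω i) ^ 2 = 1 := by
    rw [← EuclideanSpace.real_norm_sq_eq, hω, one_pow]
  simp_rw [Finset.sum_mul]
  rw [integral_finsetSum _ hi, Finset.sum_congr rfl fun i _ => key i, ← integral_finsetSum _ hj]
  refine integral_congr_ae (Eventually.of_forall fun x => ?_)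
  simp only [← Finset.mul_sum, hω2, mul_one]

lemma hasDerivAt_planeWave (hp : 0 < p) {f f' f'' : ℝ → ℝ} (hf : ∀ y, HasDerivAt f (f' y) y)
    (hf' : ∀ y, HasDerivAt f' (f'' y) y) (hf'' : Continuous f'')
    {ω : EuclideanSpace ℝ (Fin n)} (hω : ‖ω‖ = 1) {σ : ℝ} (hσ : σ ^ 2 = 1)
    {s : ℝ} (hs : 0 < s) :
    HasDerivAt (fun s => ∫ x, (D u (0, 1) s x * f (inner ℝ x ω + σ * s)
        - u x s * (σ * f' (inner ℝ x ω + σ * s))))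
      (∫ x, |u x s| ^ p * f (inner ℝ x ω + σ * s)) s := by
  have cf : Continuous f := continuous_iff_continuousAt.2 fun y => (hf y).continuousAt
  have cf' : Continuous f' := continuous_iff_continuousAt.2 fun y => (hf' y).continuousAt
  have fieldD := h.field_D (0, 1)
  have fieldDD := h.field_DD (0, 1) (0, 1)
  have hφ : ∀ {g : ℝ → ℝ}, Continuous g → ContinuousOn (Function.uncurry
      fun (s : ℝ) (x : EuclideanSpace ℝ (Fin n)) => g (inner ℝ x ω + σ * s))
      (Ioi 0 ×ˢ univ) := fun hg => by
    refine Continuous.continuousOn ?_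
    unfold Function.uncurry
    fun_prop
  have hd : ∀ s, 0 < s → ∀ x, HasDerivAt (fun s => D u (0, 1) s x * f (inner ℝ x ω + σ * s)
      - u x s * (σ * f' (inner ℝ x ω + σ * s)))
      (DD u (0, 1) (0, 1) s x * f (inner ℝ x ω + σ * s)
        - u x s * f'' (inner ℝ x ω + σ * s)) s := by
    intro s hs x
    have hin : HasDerivAt (fun s : ℝ => inner ℝ x ω + σ * s) σ s := by
      simpa using ((hasDerivAt_id s).const_mul σ).const_add (inner ℝ x ω)
    have h1 : HasDerivAt (fun s : ℝ => f (inner ℝ x ω + σ * s))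
        (f' (inner ℝ x ω + σ * s) * σ) s := (hf _).comp s hin
    have h2 : HasDerivAt (fun s : ℝ => f' (inner ℝ x ω + σ * s))
        (f'' (inner ℝ x ω + σ * s) * σ) s := (hf' _).comp s hin
    refine (((hasDerivAt_D_time h.contDiffOn (0, 1) hs x).mul h1).sub
      ((hasDerivAt_time h.contDiffOn hs x).mul (h2.const_mul σ))).congr_deriv ?_
    linear_combination -(u x s * f'' (inner ℝ x ω + σ * s)) * hσ
  have hmain := IsConeField.hasDerivAt_integral (μ := volume) (R := R)
    ((fieldD.mul_of_continuousOn (hφ cf)).sub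
      (h.field.mul_of_continuousOn (hφ (g := fun y => σ * f' y) (by fun_prop))))
    ((fieldDD.mul_of_continuousOn (hφ cf)).sub (h.field.mul_of_continuousOn (hφ hf''))) hd hs
  convert hmain using 1
  have i1 := (fieldDD.mul_of_continuousOn (hφ cf)).integrable (μ := volume) hs
  have i2 := (h.field.mul_of_continuousOn (hφ hf'')).integrable (μ := volume) hs
  have i3 := ((h.field.abs_rpow hp).mul_of_continuousOn (hφ cf)).integrable (μ := volume) hs
  rw [integral_sub i1 i2, ← h.integral_laplacian_mul_planeWave hf hf' hf'' hω (σ * s) hs]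
  have i4 : Integrable fun x => (∑ i, DD u (dir i) (dir i) s x) * f (inner ℝ x ω + σ * s) :=
    ((IsConeField.sum Finset.univ fun i _ =>
      h.field_DD (dir i) (dir i)).mul_of_continuousOn (hφ cf)).integrable hs
  rw [← integral_sub i1 i4]
  refine integral_congr_ae (Eventually.of_forall fun x => ?_)
  simp only [h.pde s hs x]
  ring

/-- Duhamel's formula tested against a plane profile `w(x · ω)`, `Ω` being a primitive of `w`. -/
lemma duhamel (hp : 0 < p) {Ω w w' : ℝ → ℝ} (hΩ : ∀ y, HasDerivAt Ω (w y) y)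
    (hw : ∀ y, HasDerivAt w (w' y) y) (hw' : Continuous w')
    {ω : EuclideanSpace ℝ (Fin n)} (hω : ‖ω‖ = 1) {a t : ℝ} (ha : 0 < a) (hat : a ≤ t) :
    2 * ∫ x, u x t * w (inner ℝ x ω)
      = (∫ x, (D u (0, 1) a x * (Ω (inner ℝ x ω + t - a) - Ω (inner ℝ x ω - t + a))
          + u x a * (w (inner ℝ x ω + t - a) + w (inner ℝ x ω - t + a))))
        + ∫ s in a..t, ∫ x, |u x s| ^ p *
          (Ω (inner ℝ x ω + t - s) - Ω (inner ℝ x ω - t + s)) := by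
  have cΩ : Continuous Ω := continuous_iff_continuousAt.2 fun y => (hΩ y).continuousAt
  have cw : Continuous w := continuous_iff_continuousAt.2 fun y => (hw y).continuousAt
  have hφ : ∀ {g : ℝ → ℝ} (σ c : ℝ), Continuous g → ContinuousOn (Function.uncurry
      fun (s : ℝ) (x : EuclideanSpace ℝ (Fin n)) => g (inner ℝ x ω + σ * s + c))
      (Ioi 0 ×ˢ univ) := fun σ c hg => by
    refine Continuous.continuousOn ?_
    unfold Function.uncurry
    fun_prop
  have shift : ∀ {g g' : ℝ → ℝ} (c : ℝ), (∀ y, HasDerivAt g (g' y) y) →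
      ∀ y, HasDerivAt (fun y => g (y + c)) (g' (y + c)) y :=
    fun c hg y => (hg (y + c)).comp_add_const y c
  have d1 := fun s hs => h.hasDerivAt_planeWave hp (shift t hΩ) (shift t hw)
    (by fun_prop) hω (σ := -1) (by norm_num) (s := s) hs
  have d2 := fun s hs => h.hasDerivAt_planeWave hp (shift (-t) hΩ) (shift (-t) hw)
    (by fun_prop) hω (σ := 1) (by norm_num) (s := s) hs
  have hd : ∀ s ∈ uIcc a t, HasDerivAt _ _ s := fun s hs => by
    have hs' : 0 < s := by
      rw [uIcc_of_le hat] at hs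
      exact ha.trans_le hs.1
    exact (d1 s hs').sub (d2 s hs')
  have fp := h.field.abs_rpow hp
  have fD := h.field_D (0, 1)
  have c1 := (fp.mul_of_continuousOn (hφ (-1) t cΩ)).continuousOn_integral (μ := volume)
  have c2 := (fp.mul_of_continuousOn (hφ 1 (-t) cΩ)).continuousOn_integral (μ := volume)
  have hsub : uIcc a t ⊆ Ioi 0 := fun s hs => by
    rw [uIcc_of_le hat] at hs
    exact ha.trans_le hs.1
  have ftc := intervalIntegral.integral_eq_sub_of_hasDerivAt hd
    ((c1.sub c2).mono hsub).intervalIntegrable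
  have ht : 0 < t := ha.trans_le hat
  have e1 : ∀ s ∈ uIcc a t, (∫ x, |u x s| ^ p * Ω (inner ℝ x ω + -1 * s + t))
      - (∫ x, |u x s| ^ p * Ω (inner ℝ x ω + 1 * s + -t))
      = ∫ x, |u x s| ^ p * (Ω (inner ℝ x ω + t - s) - Ω (inner ℝ x ω - t + s)) := by
    intro s hs
    rw [← integral_sub ((fp.mul_of_continuousOn (hφ (-1) t cΩ)).integrable (hsub hs))
      ((fp.mul_of_continuousOn (hφ 1 (-t) cΩ)).integrable (hsub hs))]
    refine integral_congr_ae (Eventually.of_forall fun x => ?_)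
    simp only
    rw [show inner ℝ x ω + -1 * s + t = inner ℝ x ω + t - s by ring,
      show inner ℝ x ω + 1 * s + -t = inner ℝ x ω - t + s by ring]
    ring
  rw [intervalIntegral.integral_congr e1] at ftc
  have e2 : ∀ s, 0 < s →
      (∫ x, (D u (0, 1) s x * Ω (inner ℝ x ω + -1 * s + t)
        - u x s * (-1 * w (inner ℝ x ω + -1 * s + t))))
      - (∫ x, (D u (0, 1) s x * Ω (inner ℝ x ω + 1 * s + -t)
        - u x s * (1 * w (inner ℝ x ω + 1 * s + -t))))
      = ∫ x, (D u (0, 1) s x * (Ω (inner ℝ x ω + t - s) - Ω (inner ℝ x ω - t + s))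
          + u x s * (w (inner ℝ x ω + t - s) + w (inner ℝ x ω - t + s))) := by
    intro s hs
    rw [← integral_sub
      (((fD.mul_of_continuousOn (hφ (-1) t cΩ)).sub (h.field.mul_of_continuousOn
        (hφ (g := fun y => -1 * w y) (-1) t (by fun_prop)))).integrable hs)
      (((fD.mul_of_continuousOn (hφ 1 (-t) cΩ)).sub (h.field.mul_of_continuousOn
        (hφ (g := fun y => 1 * w y) 1 (-t) (by fun_prop)))).integrable hs)]
    refine integral_congr_ae (Eventually.of_forall fun x => ?_)
    simp only
    rw [show inner ℝ x ω + -1 * s + t = inner ℝ x ω + t - s by ring,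
      show inner ℝ x ω + 1 * s + -t = inner ℝ x ω - t + s by ring]
    ring
  rw [Pi.sub_apply, Pi.sub_apply, e2 t ht, e2 a ha] at ftc
  have e3 : ∫ x, (D u (0, 1) t x * (Ω (inner ℝ x ω + t - t) - Ω (inner ℝ x ω - t + t))
          + u x t * (w (inner ℝ x ω + t - t) + w (inner ℝ x ω - t + t)))
      = 2 * ∫ x, u x t * w (inner ℝ x ω) := by
    rw [← integral_const_mul]
    refine integral_congr_ae (Eventually.of_forall fun x => ?_)
    simp only [add_sub_cancel_right, sub_add_cancel]
    ring
  rw [e3] at ftc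
  linarith

lemma hasDerivAt_mass {s : ℝ} (hs : 0 < s) :
    HasDerivAt (fun s => ∫ x, u x s) (∫ x, D u (0, 1) s x) s :=
  h.field.hasDerivAt_integral (h.field_D (0, 1))
    (fun _ hs x => hasDerivAt_time h.contDiffOn hs x) hs

lemma hasDerivAt_deriv_mass (hn : 0 < n) (hp : 0 < p) {s : ℝ} (hs : 0 < s) :
    HasDerivAt (fun s => ∫ x, D u (0, 1) s x) (∫ x, |u x s| ^ p) s := by
  have := h.hasDerivAt_planeWave hp (f := fun _ => 1) (f' := fun _ => 0) (f'' := fun _ => 0)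
    (fun y => hasDerivAt_const y 1) (fun y => hasDerivAt_const y 0) continuous_const
    (ω := EuclideanSpace.single ⟨0, hn⟩ 1) (by simp) (σ := 1) (by norm_num) hs
  simpa using this

end IsSolution

end PlaneWaves

namespace IsSolution

variable {n : ℕ} {p R : ℝ} {u : EuclideanSpace ℝ (Fin n) → ℝ → ℝ} (h : IsSolution n p R u)
include h

lemma hasDerivAt_energy (hp : 0 < p) {s : ℝ} (hs : 0 < s) :
    HasDerivAt (fun s => ∫ x, ((D u (0, 1) s x * D u (0, 1) s x
        + ∑ i, D u (dir i) s x * D u (dir i) s x) + u x s * u x s))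
      (∫ x, (2 * (D u (0, 1) s x * |u x s| ^ p) + 2 * (u x s * D u (0, 1) s x))) s := by
  have fD := h.field_D
  have fDD := h.field_DD
  have hd : ∀ s, 0 < s → ∀ x, HasDerivAt (fun s => (D u (0, 1) s x * D u (0, 1) s x
        + ∑ i, D u (dir i) s x * D u (dir i) s x) + u x s * u x s)
      ((2 * (D u (0, 1) s x * DD u (0, 1) (0, 1) s x)
        + ∑ i, 2 * (D u (dir i) s x * DD u (dir i) (0, 1) s x))
        + 2 * (u x s * D u (0, 1) s x)) s := by
    intro s hs x
    have h1 := hasDerivAt_D_time h.contDiffOn (0, 1) hs x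
    have h2 := hasDerivAt_time h.contDiffOn hs x
    have h3 : HasDerivAt (fun s => ∑ i, D u (dir i) s x * D u (dir i) s x)
        (∑ i, 2 * (D u (dir i) s x * DD u (dir i) (0, 1) s x)) s := by
      refine HasDerivAt.fun_sum fun i _ => ?_
      have h4 := hasDerivAt_D_time h.contDiffOn (dir i) hs x
      exact (h4.mul h4).congr_deriv (by ring)
    exact (((h1.mul h1).add h3).add (h2.mul h2)).congr_deriv (by ring)
  have f1 := ((fD (0, 1)).mul (fDD (0, 1) (0, 1))).const_mul 2
  have f2 := fun i => ((fD (dir i)).mul (fDD (dir i) (0, 1))).const_mul 2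
  have f3 := (h.field.mul (fD (0, 1))).const_mul 2
  have f4 := ((fD (0, 1)).mul (h.field.abs_rpow hp)).const_mul 2
  have f5 := fun i => ((fDD (dir i) (dir i)).mul (fD (0, 1))).const_mul 2
  have hmain := IsConeField.hasDerivAt_integral (μ := volume) (R := R)
    ((((fD (0, 1)).mul (fD (0, 1))).add
      (IsConeField.sum Finset.univ fun i _ => (fD (dir i)).mul (fD (dir i)))).add
      (h.field.mul h.field))
    ((f1.add (IsConeField.sum Finset.univ fun i _ => f2 i)).add f3) hd hs
  refine hmain.congr_deriv ?_
  have key : ∀ i : Fin n, ∫ x, 2 * (D u (dir i) s x * DD u (dir i) (0, 1) s x)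
      = -∫ x, 2 * (DD u (dir i) (dir i) s x * D u (0, 1) s x) := by
    intro i
    have e := integral_mul_lineDeriv (μ := volume) (v := EuclideanSpace.single i (1 : ℝ))
      (a := D u (dir i) s) (a' := DD u (dir i) (dir i) s)
      (b := D u (0, 1) s) (b' := DD u (dir i) (0, 1) s)
      ((fD _).continuous_slice hs) ((fDD _ _).continuous_slice hs)
      ((fD _).continuous_slice hs) ((fDD _ _).continuous_slice hs)
      ((fD _).hasCompactSupport hs) ((fDD _ _).hasCompactSupport hs)
      (fun x => by
        have := hasDerivAt_D_line h.contDiffOn (dir i) (EuclideanSpace.single i (1 : ℝ)) hs x 0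
        rwa [zero_smul, add_zero] at this)
      (fun x => by
        have := hasDerivAt_D_line h.contDiffOn (0, 1) (EuclideanSpace.single i (1 : ℝ)) hs x 0
        rw [zero_smul, add_zero] at this
        rwa [DD_comm h.contDiffOn _ _ hs])
    rw [integral_const_mul, integral_const_mul, e]
    ring
  rw [integral_add ((f1.add (IsConeField.sum Finset.univ fun i _ => f2 i)).integrable hs)
      (f3.integrable hs),
    integral_add (f1.integrable hs)
      ((IsConeField.sum Finset.univ fun i _ => f2 i).integrable hs),
    integral_finsetSum _ fun i _ => (f2 i).integrable hs,
    Finset.sum_congr rfl fun i _ => key i, Finset.sum_neg_distrib,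
    ← integral_finsetSum _ fun i _ => (f5 i).integrable hs,
    ← sub_eq_add_neg, ← integral_sub (f1.integrable hs)
      ((IsConeField.sum Finset.univ fun i _ => f5 i).integrable hs),
    integral_add (f4.integrable hs) (f3.integrable hs)]
  congr 1
  refine integral_congr_ae (Eventually.of_forall fun x => ?_)
  simp only [h.pde s hs x, ← Finset.mul_sum, ← Finset.sum_mul]
  ring

/-- A solution that vanishes from some time on vanishes identically. -/
lemma eq_zero_of_eventually_zero (hp : 1 < p) {S : ℝ} (hS : ∀ s, S < s → ∀ x, u x s = 0) :
    ∀ s, 0 < s → ∀ x, u x s = 0 := by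
  intro a ha
  rcases lt_or_ge S a with hSa | haS
  · exact hS a hSa
  have hp0 : 0 < p := by linarith
  set b := S + 1 with hb
  have hb0 : 0 < b := by linarith
  have hsub : Icc a b ⊆ Ioi 0 := fun s hs => ha.trans_le hs.1
  obtain ⟨B, hB⟩ := (isCompact_Icc.prod (isCompact_closedBall (0 : EuclideanSpace ℝ (Fin n))
    (b + R))).exists_bound_of_continuousOn (f := Function.uncurry fun s x => u x s)
    (h.field.1.mono (prod_mono hsub (subset_univ (closedBall _ (b + R)))))
  have hB' : ∀ s ∈ Icc a b, ∀ x, |u x s| ≤ max B 0 := by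
    intro s hs x
    by_cases hx : ‖x‖ ≤ b + R
    · exact (hB (s, x) ⟨hs, by simpa using hx⟩).trans (le_max_left _ _)
    · rw [h.supp s (hsub hs) x (by linarith [hs.2]), abs_zero]
      exact le_max_right _ _
  set M := (max B 0) ^ (p - 1) with hM
  have hM0 : 0 ≤ M := Real.rpow_nonneg (le_max_right _ _) _
  have hpow : ∀ s ∈ Icc a b, ∀ x, |u x s| ^ p ≤ M * |u x s| := by
    intro s hs x
    have e : |u x s| ^ p = |u x s| ^ (p - 1) * |u x s| := by
      rcases (abs_nonneg (u x s)).eq_or_lt with h0 | h0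
      · rw [← h0, Real.zero_rpow hp0.ne', mul_zero]
      · rw [← Real.rpow_add_one h0.ne', sub_add_cancel]
    rw [e]
    exact mul_le_mul_of_nonneg_right
      (Real.rpow_le_rpow (abs_nonneg _) (hB' s hs x) (by linarith)) (abs_nonneg _)
  set Φ : ℝ → ℝ := fun s => ∫ x, ((D u (0, 1) s x * D u (0, 1) s x
        + ∑ i, D u (dir i) s x * D u (dir i) s x) + u x s * u x s) with hΦ
  have fΦ := (((h.field_D (0, 1)).mul (h.field_D (0, 1))).add
      (IsConeField.sum Finset.univ fun i _ => (h.field_D (dir i)).mul (h.field_D (dir i)))).add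
      (h.field.mul h.field)
  have fd := (((h.field_D (0, 1)).mul (h.field.abs_rpow hp0)).const_mul 2).add
    ((h.field.mul (h.field_D (0, 1))).const_mul 2)
  have hΦd := fun s (hs : 0 < s) => h.hasDerivAt_energy hp0 hs
  have hlow : ∀ s ∈ Icc a b, -(M + 1) * Φ s ≤
      ∫ x, (2 * (D u (0, 1) s x * |u x s| ^ p) + 2 * (u x s * D u (0, 1) s x)) := by
    intro s hs
    rw [hΦ]
    simp only
    rw [← integral_const_mul]
    refine integral_mono ((fΦ.const_mul (-(M + 1))).integrable (hsub hs))
      (fd.integrable (hsub hs)) fun x => ?_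
    have hsum : 0 ≤ ∑ i, D u (dir i) s x * D u (dir i) s x :=
      Finset.sum_nonneg fun i _ => mul_self_nonneg _
    have h1 : -(|D u (0, 1) s x| * (M * |u x s|)) ≤ D u (0, 1) s x * |u x s| ^ p := by
      have : |D u (0, 1) s x * |u x s| ^ p| ≤ |D u (0, 1) s x| * (M * |u x s|) := by
        rw [abs_mul, abs_of_nonneg (Real.rpow_nonneg (abs_nonneg _) _)]
        exact mul_le_mul_of_nonneg_left (hpow s hs x) (abs_nonneg _)
      exact (abs_le.1 this).1
    have h2 : -(|u x s| * |D u (0, 1) s x|) ≤ u x s * D u (0, 1) s x := by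
      rw [← abs_mul]
      exact neg_abs_le _
    have h3 : 2 * (|u x s| * |D u (0, 1) s x|)
        ≤ u x s * u x s + D u (0, 1) s x * D u (0, 1) s x := by
      nlinarith [sq_nonneg (|u x s| - |D u (0, 1) s x|), abs_mul_abs_self (u x s),
        abs_mul_abs_self (D u (0, 1) s x)]
    simp only
    nlinarith [mul_nonneg (add_nonneg hM0 zero_le_one) hsum,
      mul_le_mul_of_nonneg_left h3 (add_nonneg hM0 zero_le_one)]
  have hmono : MonotoneOn (fun s => Φ s * Real.exp ((M + 1) * s)) (Icc a b) := by
    have hder : ∀ s ∈ Icc a b, HasDerivAt (fun s => Φ s * Real.exp ((M + 1) * s))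
        (((∫ x, (2 * (D u (0, 1) s x * |u x s| ^ p) + 2 * (u x s * D u (0, 1) s x)))
          + (M + 1) * Φ s) * Real.exp ((M + 1) * s)) s := by
      intro s hs
      have e : HasDerivAt (fun s => Real.exp ((M + 1) * s))
          (Real.exp ((M + 1) * s) * (M + 1)) s := by
        simpa using ((hasDerivAt_id s).const_mul (M + 1)).exp
      exact ((hΦd s (hsub hs)).mul e).congr_deriv (by ring)
    refine monotoneOn_of_deriv_nonneg (convex_Icc a b)
      (fun s hs => (hder s hs).continuousAt.continuousWithinAt)
      (fun s hs => (hder s (interior_subset hs)).differentiableAt.differentiableWithinAt)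
      fun s hs => ?_
    rw [(hder s (interior_subset hs)).deriv]
    exact mul_nonneg (by linarith [hlow s (interior_subset hs)]) (Real.exp_nonneg _)
  have hΦb : Φ b = 0 := by
    have hz : ∀ v x, D u v b x = 0 := by
      intro v x
      have : (fun q : EuclideanSpace ℝ (Fin n) × ℝ => u q.1 q.2) =ᶠ[nhds (x, b)]
          fun _ => 0 := by
        have ho : IsOpen {q : EuclideanSpace ℝ (Fin n) × ℝ | S < q.2} :=
          isOpen_lt continuous_const continuous_snd
        filter_upwards [ho.mem_nhds (show S < b by linarith)] with q hq
        exact hS _ hq _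
      simp [D, this.fderiv_eq]
    simp [hΦ, hz, hS b (by linarith)]
  have hΦa : Φ a ≤ 0 := by
    have := hmono (left_mem_Icc.2 (by linarith)) (right_mem_Icc.2 (by linarith))
      (show a ≤ b by linarith)
    simp only [hΦb, zero_mul] at this
    exact nonpos_of_mul_nonpos_left this (Real.exp_pos _)
  have hsq : ∫ x, u x a * u x a ≤ 0 := by
    refine le_trans (integral_mono ((h.field.mul h.field).integrable ha)
      (fΦ.integrable ha) fun x => ?_) hΦa
    have hsum : 0 ≤ ∑ i, D u (dir i) a x * D u (dir i) a x :=
      Finset.sum_nonneg fun i _ => mul_self_nonneg _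
    simp only
    linarith [mul_self_nonneg (D u (0, 1) a x)]
  have hnn : 0 ≤ fun x => u x a * u x a := fun x => mul_self_nonneg _
  have hzero : (fun x => u x a * u x a) = fun _ => 0 :=
    (Continuous.ae_eq_iff_eq volume ((h.field.mul h.field).continuous_slice ha)
      continuous_const).1 ((integral_eq_zero_iff_of_nonneg hnn
        ((h.field.mul h.field).integrable ha)).1 (le_antisymm hsq (integral_nonneg hnn)))
  exact fun x => mul_self_eq_zero.1 (congrFun hzero x)

end IsSolution

section Directions

variable {n : ℕ}

/-- Integration of a decaying profile against a measure with power-law sublevel sets. -/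
lemma lintegral_rpow_neg_le {X : Type*} [MeasurableSpace X] {μ : Measure X} {z : X → ℝ}
    (hz : Measurable z) {K m b δ : ℝ} (hK : 0 ≤ K) (hb : 0 < b) (hmb : m < b)
    (hδ : 0 < δ) (hz0 : ∀ᵐ x ∂μ, 0 ≤ z x)
    (hμ : ∀ η, 0 < η → μ {x | z x ≤ η} ≤ ENNReal.ofReal (K * η ^ m)) :
    ∫⁻ x, ENNReal.ofReal ((δ + z x) ^ (-b)) ∂μ
      ≤ ENNReal.ofReal (b * K / (b - m) * δ ^ (m - b)) := by
  have h1 : ∫⁻ x, ENNReal.ofReal ((δ + z x) ^ (-b)) ∂μ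
      = ∫⁻ x, ENNReal.ofReal (((δ + z x)⁻¹) ^ b) ∂μ := by
    refine lintegral_congr_ae ?_
    filter_upwards [hz0] with x hx
    rw [Real.inv_rpow (by linarith), Real.rpow_neg (by linarith)]
  have hnn : 0 ≤ᵐ[μ] fun x => (δ + z x)⁻¹ := by
    filter_upwards [hz0] with x hx
    exact inv_nonneg.2 (by linarith)
  have hmeas : AEMeasurable (fun x => (δ + z x)⁻¹) μ :=
    (measurable_const.add hz).inv.aemeasurable
  rw [h1, lintegral_rpow_eq_lintegral_meas_le_mul μ hnn hmeas hb]
  have hpt : ∀ y ∈ Ioi (0 : ℝ), μ {x | y ≤ (δ + z x)⁻¹} * ENNReal.ofReal (y ^ (b - 1))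
      ≤ (Ioc 0 δ⁻¹).indicator (fun y => ENNReal.ofReal (K * y ^ (b - m - 1))) y := by
    intro y (hy : 0 < y)
    by_cases hyδ : y ≤ δ⁻¹
    · rw [indicator_of_mem (show y ∈ Ioc 0 δ⁻¹ from ⟨hy, hyδ⟩)]
      have hsub : μ {x | y ≤ (δ + z x)⁻¹} ≤ ENNReal.ofReal (K * (y⁻¹) ^ m) := by
        refine le_trans (measure_mono_ae ?_) (hμ y⁻¹ (inv_pos.2 hy))
        filter_upwards [hz0] with x hx hxy
        have hpos : 0 < δ + z x := by linarith
        have : δ + z x ≤ y⁻¹ := (le_inv_comm₀ hy hpos).1 hxy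
        exact show z x ≤ y⁻¹ by linarith
      refine (mul_le_mul_left hsub _).trans ?_
      rw [← ENNReal.ofReal_mul (by positivity), mul_assoc, Real.inv_rpow hy.le,
        ← Real.rpow_neg hy.le, ← Real.rpow_add hy]
      exact ENNReal.ofReal_le_ofReal (le_of_eq (by ring_nf))
    · rw [indicator_of_notMem (fun h => hyδ h.2)]
      have : μ {x | y ≤ (δ + z x)⁻¹} = 0 := by
        refine measure_mono_null ?_ (ae_iff.1 hz0)
        intro x hxy
        simp only [mem_ofPred_eq] at hxy ⊢
        intro hx
        exact hyδ (hxy.trans (inv_anti₀ hδ (by linarith)))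
      simp [this]
  have hfi : IntervalIntegrable (fun y : ℝ => K * y ^ (b - m - 1)) volume 0 δ⁻¹ :=
    (intervalIntegral.intervalIntegrable_rpow' (by linarith)).const_mul K
  have hδi : (0 : ℝ) ≤ δ⁻¹ := by positivity
  have hset : ∫⁻ y in Ioi (0 : ℝ), (Ioc 0 δ⁻¹).indicator
      (fun y => ENNReal.ofReal (K * y ^ (b - m - 1))) y
      = ENNReal.ofReal (K / (b - m) * δ ^ (m - b)) := by
    rw [setLIntegral_indicator measurableSet_Ioc,
      inter_eq_left.2 Ioc_subset_Ioi_self,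
      ← ofReal_integral_eq_lintegral_ofReal ((intervalIntegrable_iff_integrableOn_Ioc_of_le hδi).1
        hfi), ← intervalIntegral.integral_of_le hδi, intervalIntegral.integral_const_mul,
      integral_rpow (Or.inl (by linarith)), sub_add_cancel, Real.zero_rpow (by linarith), sub_zero,
      Real.inv_rpow hδ.le, ← Real.rpow_neg hδ.le, neg_sub]
    · congr 1; ring
    · filter_upwards [ae_restrict_mem measurableSet_Ioc] with y hy
      exact mul_nonneg hK (Real.rpow_nonneg hy.1.le _)
  calc _ ≤ ENNReal.ofReal b * ENNReal.ofReal (K / (b - m) * δ ^ (m - b)) := by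
        rw [← hset]
        exact mul_le_mul_right (setLIntegral_mono' measurableSet_Ioi hpt) _
    _ = _ := by
        rw [← ENNReal.ofReal_mul hb.le]
        congr 1; ring

/-- The volume of the part of the unit ball inside a thin cone around a unit vector. -/
lemma volume_cap_le (hn : 0 < n) {e : EuclideanSpace ℝ (Fin n)} (he : ‖e‖ = 1) {η : ℝ}
    (hη : 0 < η) :
    volume {ξ : EuclideanSpace ℝ (Fin n) | ‖ξ‖ < 1 ∧ ξ ≠ 0 ∧ 1 - inner ℝ e (‖ξ‖⁻¹ • ξ) ≤ η}
      ≤ ENNReal.ofReal (2 * (2 * √2) ^ ((n : ℝ) - 1) * η ^ (((n : ℝ) - 1) / 2)) := by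
  set i₀ : Fin n := ⟨0, hn⟩
  obtain ⟨b, hb⟩ := Orthonormal.exists_orthonormalBasis_extension_of_card_eq
    (𝕜 := ℝ) (E := EuclideanSpace ℝ (Fin n)) (ι := Fin n) (by simp) (v := fun _ => e) (s := {i₀})
    (by
      constructor
      · intro i; simpa using he
      · intro i j hij
        exact absurd (Subsingleton.elim i j) hij)
  have hb0 : b i₀ = e := hb i₀ rfl
  set c : Fin n → ℝ := fun i => if i = i₀ then 1 else √(2 * η) with hc
  have hsub : {ξ : EuclideanSpace ℝ (Fin n) | ‖ξ‖ < 1 ∧ ξ ≠ 0 ∧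
      1 - inner ℝ e (‖ξ‖⁻¹ • ξ) ≤ η}
      ⊆ (fun ξ => WithLp.ofLp (b.repr ξ)) ⁻¹' Icc (fun i => -c i) c := by
    rintro ξ ⟨h1, h2, h3⟩
    have hpos : 0 < ‖ξ‖ := norm_pos_iff.2 h2
    have hs : ∑ i, (b.repr ξ i) ^ 2 = ‖ξ‖ ^ 2 := by
      rw [← b.repr.norm_map ξ, EuclideanSpace.norm_sq_eq]; simp
    have h0 : b.repr ξ i₀ = inner ℝ e ξ := by rw [b.repr_apply_apply, hb0]
    have hle : |inner ℝ e ξ| ≤ ‖ξ‖ := by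
      simpa [he] using abs_real_inner_le_norm e ξ
    have h3' : (1 - η) * ‖ξ‖ ≤ inner ℝ e ξ := by
      rw [inner_smul_right] at h3
      have : inner ℝ e ξ = ‖ξ‖⁻¹ * inner ℝ e ξ * ‖ξ‖ := by field_simp
      rw [this]
      exact mul_le_mul_of_nonneg_right (by linarith) hpos.le
    have habs : ∀ i, |b.repr ξ i| ≤ c i := by
      intro i
      by_cases hi : i = i₀
      · simp only [hc, hi, if_true, h0]
        linarith
      · simp only [hc, hi, if_false]
        refine Real.abs_le_sqrt ?_
        have h4 : (b.repr ξ i) ^ 2 + (b.repr ξ i₀) ^ 2 ≤ ‖ξ‖ ^ 2 := by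
          rw [← hs, ← Finset.sum_pair (f := fun j => (b.repr ξ j) ^ 2) hi]
          exact Finset.sum_le_sum_of_subset_of_nonneg (Finset.subset_univ _)
            fun j _ _ => sq_nonneg _
        rw [h0] at h4
        have h5 := abs_le.1 hle
        have h6 : (‖ξ‖ - inner ℝ e ξ) * (‖ξ‖ + inner ℝ e ξ) ≤ (η * ‖ξ‖) * (2 * ‖ξ‖) :=
          mul_le_mul (by linarith) (by linarith) (by linarith) (by positivity)
        have h7 : η * ‖ξ‖ ^ 2 ≤ η * 1 :=
          mul_le_mul_of_nonneg_left (by nlinarith) hη.le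
        linarith
    exact ⟨fun i => (abs_le.1 (habs i)).1, fun i => (abs_le.1 (habs i)).2⟩
  have hmp : MeasurePreserving (fun ξ => WithLp.ofLp (b.repr ξ)) volume volume :=
    (PiLp.volume_preserving_ofLp (Fin n)).comp b.measurePreserving_repr
  refine (measure_mono hsub).trans ?_
  rw [hmp.measure_preimage measurableSet_Icc.nullMeasurableSet, Real.volume_Icc_pi,
    ← Finset.mul_prod_erase _ _ (Finset.mem_univ i₀),
    Finset.prod_congr rfl (g := fun _ => ENNReal.ofReal (2 * √(2 * η)))
      (fun i hi => by simp [hc, (Finset.mem_erase.1 hi).1, two_mul])]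
  rw [Finset.prod_const, Finset.card_erase_of_mem (Finset.mem_univ _), Finset.card_univ,
    Fintype.card_fin, ← ENNReal.ofReal_pow (by positivity), ← ENNReal.ofReal_mul (by simp [hc])]
  refine ENNReal.ofReal_le_ofReal (le_of_eq ?_)
  have hcast : ((n - 1 : ℕ) : ℝ) = (n : ℝ) - 1 := by
    rw [Nat.cast_sub hn]; simp
  rw [← Real.rpow_natCast, hcast, Real.sqrt_mul (by norm_num), ← mul_assoc 2,
    Real.mul_rpow (by positivity) (by positivity), Real.sqrt_eq_rpow η, ← Real.rpow_mul hη.le]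
  simp only [hc, if_true]
  ring_nf

end Directions

section Averaging

variable {n : ℕ}

/-- A weighted volume bound for an annulus. -/
lemma lintegral_annulus_le (hn : 0 < n) {a c : ℝ} (ha : 0 ≤ a) (hac : a ≤ c) :
    ∫⁻ x : EuclideanSpace ℝ (Fin n), ENNReal.ofReal
        ((Icc a c).indicator (fun r => (c + 1 - r)⁻¹) ‖x‖)
      ≤ ENNReal.ofReal (n * volume.real (ball (0 : EuclideanSpace ℝ (Fin n)) 1)
          * c ^ (n - 1) * Real.log (c + 1 - a)) := by
  have : Nonempty (Fin n) := ⟨⟨0, hn⟩⟩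
  have : Nontrivial (EuclideanSpace ℝ (Fin n)) := inferInstance
  have hdim : Module.finrank ℝ (EuclideanSpace ℝ (Fin n)) = n := by simp
  set f : ℝ → ℝ := (Icc a c).indicator (fun r => (c + 1 - r)⁻¹) with hf
  have hcont : ContinuousOn (fun r : ℝ => (c + 1 - r)⁻¹) (Icc a c) := by
    refine ContinuousOn.inv₀ (by fun_prop) fun r hr => ?_
    linarith [hr.2]
  have hcont' : ContinuousOn (fun r : ℝ => r ^ (n - 1) * (c + 1 - r)⁻¹) (Icc a c) :=
    (continuousOn_id.pow _).mul hcont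
  have hmulf : (fun y : ℝ => y ^ (Module.finrank ℝ (EuclideanSpace ℝ (Fin n)) - 1) • f y)
      = (Icc a c).indicator (fun r => r ^ (n - 1) * (c + 1 - r)⁻¹) := by
    ext y
    by_cases hy : y ∈ Icc a c <;> simp [hf, hy, hdim]
  have hint1 : IntegrableOn (fun r : ℝ => r ^ (n - 1) * (c + 1 - r)⁻¹) (Icc a c) :=
    hcont'.integrableOn_compact isCompact_Icc
  have hfi : Integrable (fun x : EuclideanSpace ℝ (Fin n) => f ‖x‖) := by
    rw [integrable_fun_norm_addHaar, hmulf]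
    exact (hint1.integrable_indicator measurableSet_Icc).integrableOn
  have hf0 : ∀ r, 0 ≤ f r := by
    refine fun r => indicator_nonneg (fun r hr => ?_) r
    exact inv_nonneg.2 (by linarith [hr.2])
  rw [← ofReal_integral_eq_lintegral_ofReal hfi (Eventually.of_forall fun x => hf0 _),
    integral_fun_norm_addHaar, hmulf, hdim, nsmul_eq_mul, smul_eq_mul]
  refine ENNReal.ofReal_le_ofReal ?_
  rw [mul_assoc (n * _ : ℝ), ← mul_assoc]
  refine mul_le_mul_of_nonneg_left ?_ (by positivity)
  have hlog : ∫ r in Icc a c, (c + 1 - r)⁻¹ = Real.log (c + 1 - a) := by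
    rw [integral_Icc_eq_integral_Ioc, ← intervalIntegral.integral_of_le hac,
      intervalIntegral.integral_comp_sub_left (fun r => r⁻¹), integral_inv_of_pos]
    · simp
    · simp
    · linarith
  calc ∫ y in Ioi (0 : ℝ), (Icc a c).indicator (fun r => r ^ (n - 1) * (c + 1 - r)⁻¹) y
      ≤ ∫ y, (Icc a c).indicator (fun r => r ^ (n - 1) * (c + 1 - r)⁻¹) y := by
        refine setIntegral_le_integral (hint1.integrable_indicator measurableSet_Icc)
          (Eventually.of_forall fun y => indicator_nonneg (fun r hr => ?_) y)
        exact mul_nonneg (pow_nonneg (ha.trans hr.1) _) (inv_nonneg.2 (by linarith [hr.2]))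
    _ = ∫ r in Icc a c, r ^ (n - 1) * (c + 1 - r)⁻¹ := integral_indicator measurableSet_Icc
    _ ≤ ∫ r in Icc a c, c ^ (n - 1) * (c + 1 - r)⁻¹ := by
        refine setIntegral_mono_on hint1 ((hcont.integrableOn_compact isCompact_Icc).const_mul _)
          measurableSet_Icc fun r hr => ?_
        exact mul_le_mul_of_nonneg_right (pow_le_pow_left₀ (ha.trans hr.1) hr.2 _)
          (inv_nonneg.2 (by linarith [hr.2]))
    _ = c ^ (n - 1) * Real.log (c + 1 - a) := by rw [integral_const_mul, hlog]

/-- The punctured unit ball; its points are used to parametrise directions. -/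
def puncturedBall (n : ℕ) : Set (EuclideanSpace ℝ (Fin n)) := {ξ | ‖ξ‖ < 1 ∧ ξ ≠ 0}

/-- The unit vector in the direction of `ξ`. -/
abbrev unitDir (ξ : EuclideanSpace ℝ (Fin n)) : EuclideanSpace ℝ (Fin n) := ‖ξ‖⁻¹ • ξ

lemma norm_unitDir {ξ : EuclideanSpace ℝ (Fin n)} (hξ : ξ ≠ 0) : ‖unitDir ξ‖ = 1 := by
  rw [norm_smul, norm_inv, norm_norm, inv_mul_cancel₀ (norm_ne_zero_iff.2 hξ)]

lemma measurableSet_puncturedBall : MeasurableSet (puncturedBall n) := by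
  have : puncturedBall n = ball 0 1 \ {0} := by ext; simp [puncturedBall]
  rw [this]
  exact measurableSet_ball.diff (measurableSet_singleton 0)

lemma volume_puncturedBall_ne_top : volume (puncturedBall n) ≠ ⊤ :=
  ((measure_mono fun ξ hξ => by simpa using hξ.1).trans_lt
    (measure_ball_lt_top (x := (0 : EuclideanSpace ℝ (Fin n))) (r := 1))).ne

lemma volume_puncturedBall_ne_zero (hn : 0 < n) : volume (puncturedBall n) ≠ 0 := by
  have : Nonempty (Fin n) := ⟨⟨0, hn⟩⟩
  have h : puncturedBall n = ball 0 1 \ {0} := by ext; simp [puncturedBall]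
  rw [h, measure_sdiff_null (measure_singleton _)]
  exact (measure_ball_pos volume 0 one_pos).ne'

lemma measurable_unitDir : Measurable (unitDir : EuclideanSpace ℝ (Fin n) → _) :=
  measurable_norm.inv.smul measurable_id

/-- Averaging a decaying plane wave profile over all directions. -/
lemma lintegral_profile_le (hn : 0 < n) {b t δ W r₀ : ℝ} {w : ℝ → ℝ} (hb : 0 < b)
    (hnb : ((n : ℝ) - 1) / 2 < b) (hn1 : 0 ≤ ((n : ℝ) - 1) / 2)
    (hr₀ : 0 < r₀) (hW : 0 ≤ W) {x : EuclideanSpace ℝ (Fin n)} (hx : r₀ ≤ ‖x‖)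
    (hδ : 0 < δ) (hxδ : ‖x‖ + δ = t)
    (hw : ∀ ρ, ρ ≤ ‖x‖ → |w ρ| ≤ W * (t - ρ) ^ (-b)) :
    ∫⁻ ξ in puncturedBall n, ‖w (inner ℝ x (unitDir ξ))‖ₑ
      ≤ ENNReal.ofReal (W * (b * (2 * (2 * √2) ^ ((n : ℝ) - 1)) / (b - ((n : ℝ) - 1) / 2)
          * r₀ ^ (-(((n : ℝ) - 1) / 2)) * δ ^ (((n : ℝ) - 1) / 2 - b))) := by
  set m := ((n : ℝ) - 1) / 2 with hm
  set K : ℝ := 2 * (2 * √2) ^ ((n : ℝ) - 1) with hK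
  have hK0 : 0 ≤ K := by positivity
  have hx0 : 0 < ‖x‖ := hr₀.trans_le hx
  set z : EuclideanSpace ℝ (Fin n) → ℝ := fun ξ => ‖x‖ - inner ℝ x (unitDir ξ) with hz
  have hzm : Measurable z := measurable_const.sub (measurable_const.inner measurable_unitDir)
  have hle : ∀ ξ ∈ puncturedBall n, inner ℝ x (unitDir ξ) ≤ ‖x‖ := fun ξ hξ => by
    simpa [norm_unitDir hξ.2] using real_inner_le_norm x (unitDir ξ)
  have key := lintegral_rpow_neg_le (μ := volume.restrict (puncturedBall n)) (z := z)
    (K := K * r₀ ^ (-m)) (m := m) (b := b) (δ := δ) hzm (by positivity) hb hnb hδ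
    (by
      filter_upwards [ae_restrict_mem measurableSet_puncturedBall] with ξ hξ
      exact sub_nonneg.2 (hle ξ hξ))
    (by
      intro η hη
      rw [Measure.restrict_apply (measurableSet_le hzm measurable_const)]
      have he : ‖‖x‖⁻¹ • x‖ = 1 := norm_unitDir (norm_pos_iff.1 hx0)
      refine (measure_mono ?_).trans ((volume_cap_le hn he (div_pos hη hx0)).trans ?_)
      · rintro ξ ⟨h1, h2⟩
        refine ⟨h2.1, h2.2, ?_⟩
        have h1 : ‖x‖ - inner ℝ x (unitDir ξ) ≤ η := h1
        rw [real_inner_smul_left, le_div_iff₀ hx0, sub_mul, mul_right_comm,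
          inv_mul_cancel₀ hx0.ne', one_mul, one_mul]
        exact h1
      · refine ENNReal.ofReal_le_ofReal ?_
        rw [Real.div_rpow hη.le hx0.le, Real.rpow_neg hr₀.le]
        change K * (η ^ m / ‖x‖ ^ m) ≤ K * (r₀ ^ m)⁻¹ * η ^ m
        rw [mul_assoc K]
        refine mul_le_mul_of_nonneg_left ?_ hK0
        rw [div_eq_mul_inv, mul_comm]
        exact mul_le_mul_of_nonneg_right (inv_anti₀ (by positivity)
          (Real.rpow_le_rpow hr₀.le hx hn1)) (by positivity))
  calc _ ≤ ∫⁻ ξ in puncturedBall n, ENNReal.ofReal W * ENNReal.ofReal ((δ + z ξ) ^ (-b)) := by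
        refine setLIntegral_mono' measurableSet_puncturedBall fun ξ hξ => ?_
        rw [← ENNReal.ofReal_mul hW, Real.enorm_eq_ofReal_abs]
        refine ENNReal.ofReal_le_ofReal ((hw _ (hle ξ hξ)).trans (le_of_eq ?_))
        rw [← hxδ]
        simp only [hz]
        ring_nf
    _ = ENNReal.ofReal W * ∫⁻ ξ in puncturedBall n, ENNReal.ofReal ((δ + z ξ) ^ (-b)) :=
        lintegral_const_mul' _ _ ENNReal.ofReal_ne_top
    _ ≤ _ := by
        rw [ENNReal.ofReal_mul hW]
        refine mul_le_mul_right (key.trans (ENNReal.ofReal_le_ofReal (le_of_eq ?_))) _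
        ring

end Averaging

section PlaneWaveBound

variable {n : ℕ}

/-- Averaging plane wave integrals over directions. -/
lemma mul_volume_le_lintegral {v : EuclideanSpace ℝ (Fin n) → ℝ} {w : ℝ → ℝ} {κ : ℝ}
    (hv : Continuous v) (hw : Continuous w)
    (hκ : ∀ ω : EuclideanSpace ℝ (Fin n), ‖ω‖ = 1 →
      κ ≤ |∫ x, v x * w (inner ℝ x ω)| + |∫ x, v x * w (-inner ℝ x ω)|) :
    ENNReal.ofReal κ * volume (puncturedBall n)
      ≤ ∫⁻ x, ‖v x‖ₑ * ∫⁻ ξ in puncturedBall n, (‖w (inner ℝ x (unitDir ξ))‖ₑ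
          + ‖w (inner ℝ (-x) (unitDir ξ))‖ₑ) := by
  have hdir : Measurable fun q : EuclideanSpace ℝ (Fin n) × EuclideanSpace ℝ (Fin n) =>
      (inner ℝ q.2 (unitDir q.1) : ℝ) :=
    measurable_snd.inner (measurable_unitDir.comp measurable_fst)
  have hdir' : Measurable fun q : EuclideanSpace ℝ (Fin n) × EuclideanSpace ℝ (Fin n) =>
      (inner ℝ (-q.2) (unitDir q.1) : ℝ) :=
    measurable_snd.neg.inner (measurable_unitDir.comp measurable_fst)
  have hmeas : Measurable fun q : EuclideanSpace ℝ (Fin n) × EuclideanSpace ℝ (Fin n) =>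
      ‖v q.2‖ₑ * (‖w (inner ℝ q.2 (unitDir q.1))‖ₑ + ‖w (inner ℝ (-q.2) (unitDir q.1))‖ₑ) :=
    (hv.measurable.comp measurable_snd).enorm.mul
      ((hw.measurable.comp hdir).enorm.add (hw.measurable.comp hdir').enorm)
  calc ENNReal.ofReal κ * volume (puncturedBall n)
      = ∫⁻ ξ in puncturedBall n, ENNReal.ofReal κ := (setLIntegral_const _ _).symm
    _ ≤ ∫⁻ ξ in puncturedBall n, ∫⁻ x, ‖v x‖ₑ * (‖w (inner ℝ x (unitDir ξ))‖ₑ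
          + ‖w (inner ℝ (-x) (unitDir ξ))‖ₑ) := by
        refine setLIntegral_mono' measurableSet_puncturedBall fun ξ hξ => ?_
        refine (ENNReal.ofReal_le_ofReal (hκ _ (norm_unitDir hξ.2))).trans ?_
        rw [ENNReal.ofReal_add (abs_nonneg _) (abs_nonneg _), ← Real.enorm_eq_ofReal_abs,
          ← Real.enorm_eq_ofReal_abs]
        simp only [mul_add, inner_neg_left]
        rw [lintegral_add_left]
        · refine add_le_add ((enorm_integral_le_lintegral_enorm _).trans (le_of_eq ?_))
            ((enorm_integral_le_lintegral_enorm _).trans (le_of_eq ?_)) <;>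
          simp only [enorm_mul]
        · exact hv.measurable.enorm.mul
            (hw.measurable.comp (measurable_id.inner measurable_const)).enorm
    _ = ∫⁻ x, ∫⁻ ξ in puncturedBall n, ‖v x‖ₑ * (‖w (inner ℝ x (unitDir ξ))‖ₑ
          + ‖w (inner ℝ (-x) (unitDir ξ))‖ₑ) :=
        lintegral_lintegral_swap hmeas.aemeasurable
    _ = _ := lintegral_congr fun x => lintegral_const_mul' _ _ enorm_ne_top

lemma lintegral_enorm_rpow {v : EuclideanSpace ℝ (Fin n) → ℝ} {p r : ℝ} (hp : 0 < p)
    (hv : Continuous v) (hsupp : ∀ x, r < ‖x‖ → v x = 0) :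
    ∫⁻ x, ‖v x‖ₑ ^ p = ENNReal.ofReal (∫ x, |v x| ^ p) := by
  have hfi : Integrable fun x => |v x| ^ p := by
    refine (hv.abs.rpow_const fun _ => Or.inr hp.le).integrable_of_hasCompactSupport ?_
    refine HasCompactSupport.intro (isCompact_closedBall 0 r) fun x hx => ?_
    simp [hsupp x (by simpa using hx), hp.ne']
  rw [ofReal_integral_eq_lintegral_ofReal hfi (Eventually.of_forall fun x => by positivity)]
  exact lintegral_congr fun x => by
    rw [Real.enorm_eq_ofReal_abs, ENNReal.ofReal_rpow_of_nonneg (abs_nonneg _) hp.le]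

/-- A lower bound on plane wave integrals that is uniform in the direction forces a lower bound
on the `L^p` norm. -/
lemma rpow_le_integral_of_planeWave (hn : 2 ≤ n) {p b R W : ℝ} (hp : 1 < p) (hR : 0 < R)
    (hb : b = ((n : ℝ) - 1) / 2 + 1 - 1 / p) (hW : 0 ≤ W) :
    ∃ C, 0 < C ∧ ∀ (v : EuclideanSpace ℝ (Fin n) → ℝ) (w : ℝ → ℝ) (t B κ : ℝ),
      Continuous v → (∀ x, t + R < ‖x‖ → v x = 0) → Continuous w → R ≤ t → 0 ≤ B → B ≤ t / 2 →
      0 ≤ κ → (∀ ρ, ρ < t - B → w ρ = 0) →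
      (∀ ρ, ρ ≤ t + R → |w ρ| ≤ W * (t + R + 1 - ρ) ^ (-b)) →
      (∀ ω : EuclideanSpace ℝ (Fin n), ‖ω‖ = 1 →
        κ ≤ |∫ x, v x * w (inner ℝ x ω)| + |∫ x, v x * w (-inner ℝ x ω)|) →
      κ ^ p ≤ C * (t ^ (-((n : ℝ) - 1 - ((n : ℝ) - 1) * p / 2))
        * Real.log (R + 1 + B) ^ (p - 1)) * ∫ x, |v x| ^ p := by
  have hn0 : 0 < n := by omega
  have hnR : (2 : ℝ) ≤ n := by exact_mod_cast hn
  set m := ((n : ℝ) - 1) / 2 with hm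
  have hm0 : 0 ≤ m := by simp only [hm]; linarith
  have hpq := Real.HolderConjugate.conjExponent hp
  set p' := Real.conjExponent p with hp'
  have hp'0 : 0 < p' := hpq.symm.pos
  have hinv : b - m = 1 / p' := by
    have := hpq.inv_add_inv_eq_one
    rw [hb, one_div, one_div]; linarith
  have hmb : m < b := by
    have : 0 < 1 / p' := by positivity
    linarith
  have hb0 : 0 < b := hm0.trans_lt hmb
  set K : ℝ := 2 * (2 * √2) ^ ((n : ℝ) - 1) with hK
  set A₁ : ℝ := 2 * (W * (b * K / (b - m) * 2 ^ m)) with hA₁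
  set c₂ : ℝ := n * volume.real (ball (0 : EuclideanSpace ℝ (Fin n)) 1) * 2 ^ (n - 1) with hc₂
  set V : ℝ := volume.real (puncturedBall n) with hV
  have hVpos : 0 < V := ENNReal.toReal_pos (volume_puncturedBall_ne_zero hn0)
    volume_puncturedBall_ne_top
  have hbm : 0 < b - m := by linarith
  have hA₁0 : 0 ≤ A₁ := by positivity
  have hc₂0 : 0 ≤ c₂ := by positivity
  refine ⟨A₁ ^ p * c₂ ^ (p - 1) / V ^ p + 1, by positivity, ?_⟩
  intro v w t B κ hv hvs hw hRt hB hBt hκ0 hw0 hwb hκ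
  have ht : 0 < t := hR.trans_le hRt
  set A : ℝ := A₁ * t ^ (-m) with hA
  have hA0 : 0 ≤ A := by positivity
  set J : EuclideanSpace ℝ (Fin n) → ℝ := fun x =>
    (Icc (t - B) (t + R)).indicator (fun r => (t + R + 1 - r)⁻¹) ‖x‖ with hJ
  have hJm : Measurable J := by
    refine Measurable.comp (g := (Icc (t - B) (t + R)).indicator fun r => (t + R + 1 - r)⁻¹)
      ?_ measurable_norm
    exact (measurable_const.sub measurable_id).inv.indicator measurableSet_Icc
  set L := Real.log (R + 1 + B) with hL
  have hL0 : 0 ≤ L := Real.log_nonneg (by linarith)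
  have hJint : ∫⁻ x, ENNReal.ofReal (J x) ≤ ENNReal.ofReal (c₂ * t ^ ((n : ℝ) - 1) * L) := by
    refine (lintegral_annulus_le hn0 (by linarith) (by linarith)).trans
      (ENNReal.ofReal_le_ofReal ?_)
    have h1 : t + R + 1 - (t - B) = R + 1 + B := by ring
    have h2 : (t + R) ^ (n - 1) ≤ 2 ^ (n - 1) * t ^ ((n : ℝ) - 1) := by
      have : ((n - 1 : ℕ) : ℝ) = (n : ℝ) - 1 := by rw [Nat.cast_sub hn0]; simp
      rw [← this, Real.rpow_natCast, ← mul_pow]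
      exact pow_le_pow_left₀ (by linarith) (by linarith) _
    rw [h1]
    refine mul_le_mul_of_nonneg_right ?_ hL0
    rw [hc₂, mul_assoc (_ * _ : ℝ) (2 ^ (n - 1) : ℝ)]
    exact mul_le_mul_of_nonneg_left h2 (by positivity)
  have hpt : ∀ x, ‖v x‖ₑ * ∫⁻ ξ in puncturedBall n, (‖w (inner ℝ x (unitDir ξ))‖ₑ
      + ‖w (inner ℝ (-x) (unitDir ξ))‖ₑ)
      ≤ ‖v x‖ₑ * (ENNReal.ofReal A * ENNReal.ofReal (J x) ^ (1 / p')) := by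
    intro x
    rcases lt_or_ge (t + R) ‖x‖ with hx | hx
    · simp [hvs x hx]
    refine mul_le_mul_right ?_ _
    rcases lt_or_ge ‖x‖ (t - B) with hx' | hx'
    · refine le_of_eq_of_le ?_ zero_le
      rw [← lintegral_zero (μ := volume.restrict (puncturedBall n))]
      refine setLIntegral_congr_fun measurableSet_puncturedBall fun ξ hξ => ?_
      have h1 := real_inner_le_norm x (unitDir ξ)
      have h2 := real_inner_le_norm (-x) (unitDir ξ)
      rw [norm_unitDir hξ.2, mul_one] at h1 h2
      rw [norm_neg] at h2
      rw [hw0 _ (by linarith), hw0 _ (by linarith)]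
      simp
    · have hJx : J x = (t + R + 1 - ‖x‖)⁻¹ := indicator_of_mem (show ‖x‖ ∈ Icc _ _ from ⟨hx', hx⟩) _
      have hδ : 0 < t + R + 1 - ‖x‖ := by linarith
      have e1 := lintegral_profile_le (t := t + R + 1) (δ := t + R + 1 - ‖x‖) (r₀ := t / 2) hn0 hb0
        hmb hm0 (by linarith) hW (x := x) (by linarith) hδ (by ring)
        fun ρ hρ => hwb ρ (by linarith)
      have e2 := lintegral_profile_le (t := t + R + 1) (δ := t + R + 1 - ‖x‖) (r₀ := t / 2) hn0 hb0
        hmb hm0 (by linarith) hW (x := -x) (by rw [norm_neg]; linarith) hδ (by rw [norm_neg]; ring)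
        fun ρ hρ => hwb ρ (by rw [norm_neg] at hρ; linarith)
      rw [← hm, ← hK] at e1 e2
      rw [lintegral_add_left]
      swap
      · exact (hw.measurable.comp (measurable_const.inner measurable_unitDir)).enorm
      refine (add_le_add e1 e2).trans (le_of_eq ?_)
      have hδr : 0 ≤ (t + R + 1 - ‖x‖) ^ (m - b) := by positivity
      rw [hJx, ENNReal.ofReal_rpow_of_nonneg (by positivity) (by positivity),
        ← ENNReal.ofReal_mul hA0, ← ENNReal.ofReal_add (by positivity) (by positivity)]
      congr 1
      rw [Real.inv_rpow hδ.le, ← Real.rpow_neg hδ.le, ← hinv, neg_sub, hA, hA₁,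
        Real.div_rpow ht.le (by norm_num), Real.rpow_neg (by norm_num : (0 : ℝ) ≤ 2) m]
      field_simp
      ring
  have hgm : Measurable fun x => ENNReal.ofReal A * ENNReal.ofReal (J x) ^ (1 / p') :=
    (hJm.ennreal_ofReal.pow_const _).const_mul _
  have hH := lintegral_enorm_rpow (zero_lt_one.trans hp) hv hvs
  have hmain : ENNReal.ofReal κ * volume (puncturedBall n)
      ≤ ENNReal.ofReal (∫ x, |v x| ^ p) ^ (1 / p)
        * (ENNReal.ofReal A * ENNReal.ofReal (c₂ * t ^ ((n : ℝ) - 1) * L) ^ (1 / p')) := by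
    refine (mul_volume_le_lintegral hv hw hκ).trans ((lintegral_mono hpt).trans ?_)
    refine (ENNReal.lintegral_mul_le_Lp_mul_Lq volume hpq hv.measurable.enorm.aemeasurable
      hgm.aemeasurable).trans ?_
    rw [hH]
    refine mul_le_mul_right ?_ _
    have hpow : ∀ x, (ENNReal.ofReal A * ENNReal.ofReal (J x) ^ (1 / p')) ^ p'
        = ENNReal.ofReal A ^ p' * ENNReal.ofReal (J x) := fun x => by
      rw [ENNReal.mul_rpow_of_nonneg _ _ hp'0.le, ← ENNReal.rpow_mul, one_div,
        inv_mul_cancel₀ hp'0.ne', ENNReal.rpow_one]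
    simp only [hpow]
    rw [lintegral_const_mul _ hJm.ennreal_ofReal, ENNReal.mul_rpow_of_nonneg _ _ (by positivity),
      ← ENNReal.rpow_mul, mul_one_div_cancel hp'0.ne', ENNReal.rpow_one]
    exact mul_le_mul_right (ENNReal.rpow_le_rpow hJint (by positivity)) _
  have hh0 : 0 ≤ ∫ x, |v x| ^ p := integral_nonneg fun x => by positivity
  set h := ∫ x, |v x| ^ p with hh
  set Q := c₂ * t ^ ((n : ℝ) - 1) * L with hQ
  have hQ0 : 0 ≤ Q := by positivity
  have hreal : κ * V ≤ h ^ (1 / p) * (A * Q ^ (1 / p')) := by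
    rw [← ENNReal.ofReal_toReal (volume_puncturedBall_ne_top (n := n)),
      ENNReal.ofReal_rpow_of_nonneg hh0 (by positivity),
      ENNReal.ofReal_rpow_of_nonneg hQ0 (by positivity), ← ENNReal.ofReal_mul hA0,
      ← ENNReal.ofReal_mul hκ0, ← ENNReal.ofReal_mul (by positivity)] at hmain
    exact (ENNReal.ofReal_le_ofReal_iff (by positivity)).1 hmain
  have hp0 : 0 < p := by linarith
  have hpp : 1 / p' * p = p - 1 := by
    rw [hp', Real.conjExponent]; field_simp
  have hpow : κ ^ p * V ^ p ≤ h * (A ^ p * Q ^ (p - 1)) := by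
    have := Real.rpow_le_rpow (by positivity) hreal hp0.le
    rwa [Real.mul_rpow hκ0 hVpos.le, Real.mul_rpow (by positivity) (by positivity),
      Real.mul_rpow hA0 (by positivity), ← Real.rpow_mul hh0, ← Real.rpow_mul hQ0,
      one_div_mul_cancel hp0.ne', Real.rpow_one, hpp] at this
  have hAQ : A ^ p * Q ^ (p - 1) = A₁ ^ p * c₂ ^ (p - 1)
      * (t ^ (-((n : ℝ) - 1 - ((n : ℝ) - 1) * p / 2)) * L ^ (p - 1)) := by
    rw [hA, hQ, Real.mul_rpow hA₁0 (by positivity), Real.mul_rpow (by positivity) hL0,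
      Real.mul_rpow hc₂0 (by positivity), ← Real.rpow_mul ht.le, ← Real.rpow_mul ht.le]
    have : t ^ (-((n : ℝ) - 1 - ((n : ℝ) - 1) * p / 2))
        = t ^ (-m * p) * t ^ (((n : ℝ) - 1) * (p - 1)) := by
      rw [← Real.rpow_add ht, hm]
      congr 1; ring
    rw [this]; ring
  have hVp : 0 < V ^ p := by positivity
  calc κ ^ p = κ ^ p * V ^ p / V ^ p := by field_simp
    _ ≤ h * (A ^ p * Q ^ (p - 1)) / V ^ p := by gcongr
    _ = A₁ ^ p * c₂ ^ (p - 1) / V ^ p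
        * (t ^ (-((n : ℝ) - 1 - ((n : ℝ) - 1) * p / 2)) * L ^ (p - 1)) * h := by
        rw [hAQ]; ring
    _ ≤ _ := by
        gcongr
        linarith

end PlaneWaveBound

section Front

/-- The derivative of the smooth transition function. -/
def bump : ℝ → ℝ := deriv Real.smoothTransition

lemma contDiff_smoothTransition : ContDiff ℝ 2 Real.smoothTransition :=
  Real.smoothTransition.contDiff (n := 2)

lemma contDiff_bump : ContDiff ℝ 1 bump :=
  (contDiff_succ_iff_deriv (n := 1).1 contDiff_smoothTransition).2.2

lemma hasDerivAt_smoothTransition (y : ℝ) : HasDerivAt Real.smoothTransition (bump y) y :=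
  (contDiff_smoothTransition.differentiable (by norm_num) y).hasDerivAt

lemma hasDerivAt_bump (y : ℝ) : HasDerivAt bump (deriv bump y) y :=
  (contDiff_bump.differentiable (by norm_num) y).hasDerivAt

lemma continuous_deriv_bump : Continuous (deriv bump) := contDiff_bump.continuous_deriv le_rfl

lemma bump_of_neg {y : ℝ} (hy : y < 0) : bump y = 0 := by
  have : Real.smoothTransition =ᶠ[nhds y] fun _ => 0 := by
    filter_upwards [Iio_mem_nhds hy] with z hz
    exact Real.smoothTransition.zero_of_nonpos (le_of_lt hz)
  rw [bump, this.deriv_eq, deriv_const]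

lemma bump_of_one_lt {y : ℝ} (hy : 1 < y) : bump y = 0 := by
  have : Real.smoothTransition =ᶠ[nhds y] fun _ => 1 := by
    filter_upwards [Ioi_mem_nhds hy] with z hz
    exact Real.smoothTransition.one_of_one_le (le_of_lt hz)
  rw [bump, this.deriv_eq, deriv_const]

lemma exists_abs_bump_le : ∃ M, 0 ≤ M ∧ ∀ y, |bump y| ≤ M := by
  obtain ⟨M, hM⟩ := isCompact_Icc.exists_bound_of_continuousOn (s := Icc (0 : ℝ) 1)
    contDiff_bump.continuous.continuousOn
  refine ⟨M, (norm_nonneg _).trans (hM 0 (by simp)), fun y => ?_⟩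
  by_cases hy : y ∈ Icc (0 : ℝ) 1
  · exact hM y hy
  · have h0 : bump y = 0 := by
      rcases lt_or_ge y 0 with h | h
      · exact bump_of_neg h
      · exact bump_of_one_lt (not_le.1 fun h1 => hy ⟨h, h1⟩)
    rw [h0, abs_zero]
    exact (norm_nonneg _).trans (hM 0 (by simp))

end Front

namespace IsSolution

variable {n : ℕ} {p R : ℝ} {u : EuclideanSpace ℝ (Fin n) → ℝ → ℝ} (h : IsSolution n p R u)
include h

lemma field_source (hp : 0 < p) {Φ : ℝ → EuclideanSpace ℝ (Fin n) → ℝ}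
    (hΦ : Continuous (Function.uncurry Φ)) : IsConeField R (fun s x => |u x s| ^ p * Φ s x) :=
  (h.field.abs_rpow hp).mul_of_continuousOn hΦ.continuousOn

lemma intervalIntegrable_source (hp : 0 < p) {Φ : ℝ → EuclideanSpace ℝ (Fin n) → ℝ}
    (hΦ : Continuous (Function.uncurry Φ)) {a c : ℝ} (ha : 0 < a) (hc : 0 < c) :
    IntervalIntegrable (fun s => ∫ x, |u x s| ^ p * Φ s x) volume a c :=
  ((h.field_source hp hΦ).continuousOn_integral.mono fun _ hs =>
    (lt_min ha hc).trans_le hs.1).intervalIntegrable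

lemma continuousOn_norm (hp : 0 < p) : ContinuousOn (fun s => ∫ x, |u x s| ^ p) (Ioi 0) :=
  (h.field.abs_rpow hp).continuousOn_integral

lemma intervalIntegrable_norm (hp : 0 < p) {a c : ℝ} (ha : 0 < a) (hc : 0 < c) :
    IntervalIntegrable (fun s => ∫ x, |u x s| ^ p) volume a c :=
  ((h.continuousOn_norm hp).mono fun _ hs => (lt_min ha hc).trans_le hs.1).intervalIntegrable

lemma integral_norm_eq (hn : 0 < n) (hp : 0 < p) {a c : ℝ} (ha : 0 < a) (hc : 0 < c) :
    ∫ s in a..c, ∫ x, |u x s| ^ p = (∫ x, D u (0, 1) c x) - ∫ x, D u (0, 1) a x :=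
  intervalIntegral.integral_eq_sub_of_hasDerivAt
    (fun _ hs => h.hasDerivAt_deriv_mass hn hp ((lt_min ha hc).trans_le hs.1))
    (h.intervalIntegrable_norm hp ha hc)

/-- The integral of the solution against a profile concentrated near a characteristic plane. -/
lemma integral_front (hp : 0 < p) {A t : ℝ} (hR : 0 < R) (hA : R + 3 ≤ A) (ht : A + R + 3 ≤ t)
    {ω : EuclideanSpace ℝ (Fin n)} (hω : ‖ω‖ = 1) :
    2 * ∫ x, u x t * bump (inner ℝ x ω - t + A + 1)
      = (∫ x, D u (0, 1) 1 x) + ∫ s in (1 : ℝ)..t, ∫ x, |u x s| ^ p *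
        (Real.smoothTransition (inner ℝ x ω - s + A + 1)
          - Real.smoothTransition (inner ℝ x ω - 2 * t + s + A + 1)) := by
  have hsh : ∀ y : ℝ, HasDerivAt (fun y : ℝ => y - t + A + 1) 1 y := fun y =>
    (((hasDerivAt_id y).sub_const t).add_const A).add_const 1
  have key := h.duhamel hp (Ω := fun y => Real.smoothTransition (y - t + A + 1))
    (w := fun y => bump (y - t + A + 1)) (w' := fun y => deriv bump (y - t + A + 1))
    (fun y => (HasDerivAt.comp (h₂ := Real.smoothTransition) y
      (hasDerivAt_smoothTransition (y - t + A + 1)) (hsh y)).congr_deriv (mul_one _))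
    (fun y => (HasDerivAt.comp (h₂ := bump) y (hasDerivAt_bump (y - t + A + 1))
      (hsh y)).congr_deriv (mul_one _))
    (continuous_deriv_bump.comp (by fun_prop)) hω one_pos (show 1 ≤ t by linarith)
  rw [key]
  congr 1
  · refine integral_congr_ae (Eventually.of_forall fun x => ?_)
    simp only
    rcases lt_or_ge (1 + R) ‖x‖ with hx | hx
    · rw [(h.field_D (0, 1)).eq_zero 1 one_pos x hx, h.supp 1 one_pos x hx]
      simp
    · have h1 : |inner ℝ x ω| ≤ 1 + R := by
        have := abs_real_inner_le_norm x ω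
        rw [hω, mul_one] at this
        exact this.trans hx
      obtain ⟨h2, h3⟩ := abs_le.1 h1
      rw [Real.smoothTransition.one_of_one_le (by linarith),
        Real.smoothTransition.zero_of_nonpos (by linarith), bump_of_one_lt (by linarith),
        bump_of_neg (by linarith)]
      ring
  · refine intervalIntegral.integral_congr fun s _ => ?_
    refine integral_congr_ae (Eventually.of_forall fun x => ?_)
    simp only
    ring_nf

lemma exists_front_bound_of_pos (hn : 0 < n) (hp : 0 < p) (hR : 0 < R) {t₀ : ℝ} (ht₀ : 1 ≤ t₀)
    (hF : 0 < ∫ x, D u (0, 1) t₀ x) :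
    ∃ κ A t₁ : ℝ, 0 < κ ∧ 0 ≤ A ∧ ∀ t, t₁ ≤ t → ∀ ω : EuclideanSpace ℝ (Fin n), ‖ω‖ = 1 →
      κ ≤ |∫ x, u x t * bump (inner ℝ x ω - t + A + 1)|
        + |∫ x, u x t * bump (-inner ℝ x ω - t + A + 1)| := by
  refine ⟨(∫ x, D u (0, 1) t₀ x) / 2, 2 * t₀ + R + 1, 3 * t₀ + 2 * R + 4, by linarith,
    by linarith, fun t ht ω hω => ?_⟩
  set A := 2 * t₀ + R + 1 with hA
  have key := h.integral_front hp hR (A := A) (t := t) (by linarith) (by linarith) hω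
  set Φ : ℝ → EuclideanSpace ℝ (Fin n) → ℝ := fun s x =>
    Real.smoothTransition (inner ℝ x ω - s + A + 1)
      - Real.smoothTransition (inner ℝ x ω - 2 * t + s + A + 1) with hΦ
  have hΦc : Continuous (Function.uncurry Φ) := by
    simp only [hΦ, Function.uncurry_def]
    exact (Real.smoothTransition.continuous.comp (by fun_prop)).sub
      (Real.smoothTransition.continuous.comp (by fun_prop))
  have hnn : ∀ s ∈ Icc t₀ t, 0 ≤ ∫ x, |u x s| ^ p * Φ s x := fun s hs =>
    integral_nonneg fun x => mul_nonneg (by positivity)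
      (sub_nonneg.2 (Real.smoothTransition.monotone (by linarith [hs.2])))
  have heq : ∫ s in (1 : ℝ)..t₀, ∫ x, |u x s| ^ p * Φ s x
      = ∫ s in (1 : ℝ)..t₀, ∫ x, |u x s| ^ p := by
    refine intervalIntegral.integral_congr fun s hs => ?_
    rw [uIcc_of_le ht₀] at hs
    refine integral_congr_ae (Eventually.of_forall fun x => ?_)
    simp only
    have hs0 : 0 < s := by linarith [hs.1]
    rcases lt_or_ge (s + R) ‖x‖ with hx | hx
    · simp [h.supp s hs0 x hx, hp.ne']
    · have h1 := abs_real_inner_le_norm x ω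
      rw [hω, mul_one] at h1
      obtain ⟨h2, h3⟩ := abs_le.1 (h1.trans hx)
      simp only [hΦ]
      rw [Real.smoothTransition.one_of_one_le (by linarith [hs.2]),
        Real.smoothTransition.zero_of_nonpos (by linarith [hs.2])]
      ring
  have hsplit := intervalIntegral.integral_add_adjacent_intervals
    (h.intervalIntegrable_source hp hΦc one_pos (show 0 < t₀ by linarith))
    (h.intervalIntegrable_source hp hΦc (show 0 < t₀ by linarith) (show 0 < t by linarith))
  have htail : 0 ≤ ∫ s in t₀..t, ∫ x, |u x s| ^ p * Φ s x :=
    intervalIntegral.integral_nonneg (by linarith) hnn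
  rw [h.integral_norm_eq hn hp one_pos (by linarith)] at heq
  have : ∫ x, D u (0, 1) t₀ x ≤ 2 * ∫ x, u x t * bump (inner ℝ x ω - t + A + 1) := by
    rw [key]; linarith
  have h3 := le_abs_self (∫ x, u x t * bump (inner ℝ x ω - t + A + 1))
  have h4 := abs_nonneg (∫ x, u x t * bump (-inner ℝ x ω - t + A + 1))
  linarith

lemma exists_front_bound_of_nonpos (hn : 0 < n) (hp : 1 < p) (hR : 0 < R)
    (hF : ∀ t, 1 ≤ t → ∫ x, D u (0, 1) t x ≤ 0) (hu : ∃ s, 0 < s ∧ ∃ x, u x s ≠ 0) :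
    ∃ κ A t₁ : ℝ, 0 < κ ∧ 0 ≤ A ∧ ∀ t, t₁ ≤ t → ∀ ω : EuclideanSpace ℝ (Fin n), ‖ω‖ = 1 →
      κ ≤ |∫ x, u x t * bump (inner ℝ x ω - t + A + 1)|
        + |∫ x, u x t * bump (-inner ℝ x ω - t + A + 1)| := by
  have hp0 : 0 < p := by linarith
  set A := R + 3 with hA
  obtain ⟨s₀, hs₀, x₀, hx₀⟩ : ∃ s, A + 1 < s ∧ ∃ x, u x s ≠ 0 := by
    by_contra! hcon
    obtain ⟨s, hs, x, hx⟩ := hu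
    exact hx (h.eq_zero_of_eventually_zero hp hcon s hs x)
  have hnn : ∀ s, 0 ≤ ∫ x, |u x s| ^ p := fun s => integral_nonneg fun x => by positivity
  have hs₀0 : 0 < s₀ := by linarith
  have hpos : 0 < ∫ x, |u x s₀| ^ p := by
    refine (hnn s₀).lt_of_ne fun h0 => hx₀ ?_
    have hf := h.field.abs_rpow hp0
    have := (Continuous.ae_eq_iff_eq volume (hf.continuous_slice hs₀0)
      continuous_const).1 ((integral_eq_zero_iff_of_nonneg (fun x => by positivity)
        (hf.integrable hs₀0)).1 h0.symm)
    exact abs_eq_zero.1 ((Real.rpow_eq_zero (abs_nonneg _) hp0.ne').1 (congrFun this x₀))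
  have hI : 0 < ∫ s in (A + 1)..(s₀ + 1), ∫ x, |u x s| ^ p :=
    intervalIntegral.integral_pos (by linarith)
      ((h.continuousOn_norm hp0).mono fun s hs => show 0 < s by linarith [hs.1])
      (fun s _ => hnn s) ⟨s₀, ⟨by linarith, by linarith⟩, hpos⟩
  refine ⟨(∫ s in (A + 1)..(s₀ + 1), ∫ x, |u x s| ^ p) / 2, A, s₀ + A + R + 3, by linarith,
    by linarith, fun t ht ω hω => ?_⟩
  have hts : s₀ + 1 ≤ t := by linarith
  have k₁ := h.integral_front hp0 hR (A := A) (t := t) le_rfl (by linarith) hω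
  have k₂ := h.integral_front hp0 hR (A := A) (t := t) le_rfl (by linarith)
    (ω := -ω) (by rwa [norm_neg])
  simp only [inner_neg_right] at k₂
  set Φ : ℝ → ℝ → EuclideanSpace ℝ (Fin n) → ℝ := fun σ s x =>
    Real.smoothTransition (σ * inner ℝ x ω - s + A + 1)
      - Real.smoothTransition (σ * inner ℝ x ω - 2 * t + s + A + 1) with hΦ
  have hΦc : ∀ σ, Continuous (Function.uncurry (Φ σ)) := fun σ => by
    simp only [hΦ, Function.uncurry_def]
    exact (Real.smoothTransition.continuous.comp (by fun_prop)).sub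
      (Real.smoothTransition.continuous.comp (by fun_prop))
  have e₁ : ∀ s x, Real.smoothTransition (inner ℝ x ω - s + A + 1)
      - Real.smoothTransition (inner ℝ x ω - 2 * t + s + A + 1) = Φ 1 s x := fun s x => by
    simp [hΦ]
  have e₂ : ∀ s x, Real.smoothTransition (-inner ℝ x ω - s + A + 1)
      - Real.smoothTransition (-inner ℝ x ω - 2 * t + s + A + 1) = Φ (-1) s x := fun s x => by
    simp [hΦ]
  simp only [e₁] at k₁
  simp only [e₂] at k₂
  have ht0 : 0 < t := by linarith
  have hA0 : 0 < A + 1 := by linarith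
  have hpt : ∀ s, 0 < s → ∀ c : ℝ, (∀ x, Φ 1 s x + Φ (-1) s x ≤ c) →
      (∫ x, |u x s| ^ p * Φ 1 s x) + ∫ x, |u x s| ^ p * Φ (-1) s x
        ≤ c * ∫ x, |u x s| ^ p := fun s hs c hc => by
    have i₁ := (h.field_source hp0 (hΦc 1)).integrable hs (μ := volume)
    have i₂ := (h.field_source hp0 (hΦc (-1))).integrable hs (μ := volume)
    rw [← integral_add i₁ i₂, ← integral_const_mul]
    refine integral_mono (i₁.add i₂) (((h.field.abs_rpow hp0).integrable hs).const_mul c)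
      fun x => ?_
    have := mul_le_mul_of_nonneg_left (hc x) (show 0 ≤ |u x s| ^ p by positivity)
    simp only
    linarith
  have ii : ∀ {a c : ℝ}, 0 < a → 0 < c → IntervalIntegrable (fun s =>
      (∫ x, |u x s| ^ p * Φ 1 s x) + ∫ x, |u x s| ^ p * Φ (-1) s x) volume a c :=
    fun ha hc => (h.intervalIntegrable_source hp0 (hΦc 1) ha hc).add
      (h.intervalIntegrable_source hp0 (hΦc (-1)) ha hc)
  have b₁ : ∫ s in (1 : ℝ)..(A + 1), ((∫ x, |u x s| ^ p * Φ 1 s x)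
      + ∫ x, |u x s| ^ p * Φ (-1) s x) ≤ 2 * ∫ s in (1 : ℝ)..(A + 1), ∫ x, |u x s| ^ p := by
    rw [← intervalIntegral.integral_const_mul]
    refine intervalIntegral.integral_mono_on (by linarith) (ii one_pos hA0)
      ((h.intervalIntegrable_norm hp0 one_pos hA0).const_mul 2) fun s hs =>
      hpt s (by linarith [hs.1]) 2 fun x => ?_
    simp only [hΦ]
    linarith [Real.smoothTransition.le_one (1 * inner ℝ x ω - s + A + 1),
      Real.smoothTransition.le_one (-1 * inner ℝ x ω - s + A + 1),
      Real.smoothTransition.nonneg (1 * inner ℝ x ω - 2 * t + s + A + 1),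
      Real.smoothTransition.nonneg (-1 * inner ℝ x ω - 2 * t + s + A + 1)]
  have b₂ : ∫ s in (A + 1)..t, ((∫ x, |u x s| ^ p * Φ 1 s x)
      + ∫ x, |u x s| ^ p * Φ (-1) s x) ≤ 1 * ∫ s in (A + 1)..t, ∫ x, |u x s| ^ p := by
    rw [← intervalIntegral.integral_const_mul]
    refine intervalIntegral.integral_mono_on (by linarith) (ii hA0 ht0)
      ((h.intervalIntegrable_norm hp0 hA0 ht0).const_mul 1) fun s hs =>
      hpt s (by linarith [hs.1]) 1 fun x => ?_
    have l₁ := Real.smoothTransition.le_one (1 * inner ℝ x ω - s + A + 1)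
    have l₂ := Real.smoothTransition.le_one (-1 * inner ℝ x ω - s + A + 1)
    have l₃ := Real.smoothTransition.nonneg (1 * inner ℝ x ω - 2 * t + s + A + 1)
    have l₄ := Real.smoothTransition.nonneg (-1 * inner ℝ x ω - 2 * t + s + A + 1)
    simp only [hΦ]
    rcases le_total (inner ℝ x ω) 0 with hx | hx
    · have := Real.smoothTransition.zero_of_nonpos
        (show 1 * inner ℝ x ω - s + A + 1 ≤ 0 by linarith [hs.1])
      linarith
    · have := Real.smoothTransition.zero_of_nonpos
        (show -1 * inner ℝ x ω - s + A + 1 ≤ 0 by linarith [hs.1])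
      linarith
  have s₁ := intervalIntegral.integral_add_adjacent_intervals (ii one_pos hA0) (ii hA0 ht0)
  have s₂ := intervalIntegral.integral_add_adjacent_intervals
    (h.intervalIntegrable_norm hp0 one_pos hA0) (h.intervalIntegrable_norm hp0 hA0 ht0)
  have s₃ := intervalIntegral.integral_add_adjacent_intervals
    (h.intervalIntegrable_norm hp0 hA0 (show 0 < s₀ + 1 by linarith))
    (h.intervalIntegrable_norm hp0 (show 0 < s₀ + 1 by linarith) ht0)
  have s₄ := intervalIntegral.integral_add
    (h.intervalIntegrable_source hp0 (hΦc 1) one_pos ht0)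
    (h.intervalIntegrable_source hp0 (hΦc (-1)) one_pos ht0)
  have n₁ : 0 ≤ ∫ s in (s₀ + 1)..t, ∫ x, |u x s| ^ p :=
    intervalIntegral.integral_nonneg hts fun s _ => hnn s
  have f₁ := h.integral_norm_eq hn hp0 one_pos ht0
  have f₂ := hF t (by linarith)
  have a₁ := neg_le_abs (∫ x, u x t * bump (inner ℝ x ω - t + A + 1))
  have a₂ := neg_le_abs (∫ x, u x t * bump (-inner ℝ x ω - t + A + 1))
  linarith

end IsSolution

namespace IsSolution

variable {n : ℕ} {p R : ℝ} {u : EuclideanSpace ℝ (Fin n) → ℝ → ℝ} (h : IsSolution n p R u)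
include h

lemma exists_front_bound (hn : 0 < n) (hp : 1 < p) (hR : 0 < R)
    (hu : ∃ s, 0 < s ∧ ∃ x, u x s ≠ 0) :
    ∃ κ A t₁ : ℝ, 0 < κ ∧ 0 ≤ A ∧ ∀ t, t₁ ≤ t → ∀ ω : EuclideanSpace ℝ (Fin n), ‖ω‖ = 1 →
      κ ≤ |∫ x, u x t * bump (inner ℝ x ω - t + A + 1)|
        + |∫ x, u x t * bump (-inner ℝ x ω - t + A + 1)| := by
  by_cases hF : ∃ t, 1 ≤ t ∧ 0 < ∫ x, D u (0, 1) t x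
  · obtain ⟨t₀, ht₀, hF⟩ := hF
    exact h.exists_front_bound_of_pos hn (by linarith) hR ht₀ hF
  · push Not at hF
    exact h.exists_front_bound_of_nonpos hn hp hR hF hu

/-- The power lower bound for the nonlinear term. -/
lemma exists_power_le_integral (hn : 2 ≤ n) (hp : 1 < p) (hR : 0 < R)
    (hb : 0 ≤ ((n : ℝ) - 1) / 2 + 1 - 1 / p) (hu : ∃ s, 0 < s ∧ ∃ x, u x s ≠ 0) :
    ∃ c s₁ : ℝ, 0 < c ∧ ∀ t, s₁ ≤ t →
      c * t ^ ((n : ℝ) - 1 - ((n : ℝ) - 1) * p / 2) ≤ ∫ x, |u x t| ^ p := by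
  obtain ⟨κ, A, t₁, hκ, hA, hfront⟩ := h.exists_front_bound (by omega) hp hR hu
  obtain ⟨M, hM, hbump⟩ := exists_abs_bump_le
  set b := ((n : ℝ) - 1) / 2 + 1 - 1 / p with hb_def
  set q := (n : ℝ) - 1 - ((n : ℝ) - 1) * p / 2 with hq
  have hAR : 0 < A + R + 2 := by linarith
  obtain ⟨C, hC, key⟩ := rpow_le_integral_of_planeWave hn hp hR hb_def
    (show 0 ≤ M * (A + R + 2) ^ b by positivity)
  have hL : 0 < Real.log (R + 1 + (A + 1)) := Real.log_pos (by linarith)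
  set K := C * Real.log (R + 1 + (A + 1)) ^ (p - 1) with hK
  have hK0 : 0 < K := by positivity
  refine ⟨κ ^ p / K, max t₁ (R + 2 * (A + 1)), by positivity, fun t ht => ?_⟩
  have ht₁ : t₁ ≤ t := (le_max_left _ _).trans ht
  have ht₂ : R + 2 * (A + 1) ≤ t := (le_max_right _ _).trans ht
  have ht0 : 0 < t := by linarith
  have := key (fun x => u x t) (fun ρ => bump (ρ - t + A + 1)) t (A + 1) κ
    (h.field.continuous_slice ht0) (h.supp t ht0)
    (contDiff_bump.continuous.comp (by fun_prop)) (by linarith) (by linarith) (by linarith) hκ.le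
    (fun ρ hρ => bump_of_neg (by linarith)) (fun ρ hρ => ?_) (fun ω hω => hfront t ht₁ ω hω)
  · rw [Real.rpow_neg ht0.le] at this
    have hq0 : 0 < t ^ q := by positivity
    rw [div_mul_eq_mul_div, div_le_iff₀ hK0]
    calc κ ^ p * t ^ q ≤ (C * ((t ^ q)⁻¹ * Real.log (R + 1 + (A + 1)) ^ (p - 1))
          * ∫ x, |u x t| ^ p) * t ^ q := by gcongr
      _ = (∫ x, |u x t| ^ p) * K := by
        rw [hK]; field_simp
  · rcases lt_or_ge ρ (t - A - 1) with hρ' | hρ'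
    · rw [bump_of_neg (by linarith), abs_zero]
      have : 0 < t + R + 1 - ρ := by linarith
      positivity
    · have h0 : 0 < t + R + 1 - ρ := by linarith
      refine (hbump _).trans ?_
      rw [mul_assoc, Real.rpow_neg h0.le, ← div_eq_mul_inv]
      refine le_mul_of_one_le_right hM ((one_le_div (by positivity)).2 ?_)
      exact Real.rpow_le_rpow h0.le (by linarith) hb

end IsSolution

/-- A smooth profile `w ≤ (t + R + 1 - ρ)^(-b)` supported in `ρ ≥ t / 2`, with its primitive. -/
lemma exists_polynomial_profile {b R t : ℝ} (hb : 2 ≤ b) (hR : 0 < R) (ht : 0 < t) :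
    ∃ Ω w w' : ℝ → ℝ, (∀ y, HasDerivAt Ω (w y) y) ∧ (∀ y, HasDerivAt w (w' y) y) ∧
      Continuous w' ∧ (∀ y, y < t / 2 → w y = 0) ∧ (∀ y, 0 ≤ w y) ∧ (∀ y, w y ≤ 1) ∧
      (∀ y, y ≤ t + R → w y ≤ (t + R + 1 - y) ^ (-b)) ∧
      Monotone Ω ∧ (∀ y z, Ω y - Ω z ≤ Real.pi) ∧
      ∀ s, 2 * R + 1 ≤ s → s ≤ t / 16 →
        5 ^ (-b) * s ^ (1 - b) ≤ Ω (t - 2 * s - R) - Ω (t - 3 * s - R) := by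
  set τ := t + R + 1 with hτ
  set g : ℝ → ℝ := fun y => (1 + (τ - y) ^ 2) ^ (-b / 2) with hg
  set w : ℝ → ℝ := fun y => Real.smoothTransition ((y - t / 2) / (t / 4)) * g y with hw
  have hpos : ∀ y, 0 < 1 + (τ - y) ^ 2 := fun y => by positivity
  have hg0 : ∀ y, 0 < g y := fun y => Real.rpow_pos_of_pos (hpos y) _
  have hw0 : ∀ y, 0 ≤ w y := fun y => mul_nonneg (Real.smoothTransition.nonneg _) (hg0 y).le
  have hwg : ∀ y, w y ≤ g y := fun y =>
    mul_le_of_le_one_left (hg0 y).le (Real.smoothTransition.le_one _)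
  have hcd : ContDiff ℝ 1 w := by
    refine ContDiff.mul ?_ ?_
    · exact (Real.smoothTransition.contDiff (n := 1)).comp (by fun_prop)
    · exact ContDiff.rpow_const_of_ne (by fun_prop) fun y => (hpos y).ne'
  have hgle : ∀ y, g y ≤ (1 + (τ - y) ^ 2)⁻¹ := fun y => by
    rw [← Real.rpow_neg_one]
    exact Real.rpow_le_rpow_of_exponent_le (by nlinarith [sq_nonneg (τ - y)]) (by linarith)
  have hΩ : ∀ y, HasDerivAt (fun y => ∫ r in (0 : ℝ)..y, w r) (w y) y := fun y =>
    (hcd.continuous.integral_hasStrictDerivAt 0 y).hasDerivAt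
  have hmono : Monotone (fun y => ∫ r in (0 : ℝ)..y, w r) :=
    monotone_of_hasDerivAt_nonneg hΩ hw0
  refine ⟨fun y => ∫ r in (0 : ℝ)..y, w r, w, deriv w, hΩ,
    fun y => (hcd.differentiable one_ne_zero y).hasDerivAt, hcd.continuous_deriv le_rfl,
    fun y hy => ?_, hw0, fun y => ?_, fun y hy => ?_, hmono, fun y z => ?_, fun s hs hst => ?_⟩
  · simp only [hw]
    rw [Real.smoothTransition.zero_of_nonpos, zero_mul]
    exact div_nonpos_of_nonpos_of_nonneg (by linarith) (by linarith)
  · exact ((hwg y).trans (hgle y)).trans (inv_le_one_of_one_le₀ (by nlinarith [sq_nonneg (τ - y)]))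
  · have h0 : 0 < τ - y := by linarith
    refine (hwg y).trans ?_
    calc g y ≤ ((τ - y) ^ 2) ^ (-b / 2) :=
          Real.rpow_le_rpow_of_nonpos (by positivity) (by linarith) (by linarith)
      _ = (τ - y) ^ (-b) := by
        rw [← Real.rpow_natCast, ← Real.rpow_mul h0.le]
        congr 1
        push_cast
        ring
  · have hJ : Monotone fun y => Real.arctan (y - τ) - ∫ r in (0 : ℝ)..y, w r := by
      refine monotone_of_hasDerivAt_nonneg (f' := fun y => 1 / (1 + (y - τ) ^ 2) * 1 - w y)
        (fun y => ((((hasDerivAt_id y).sub_const τ).arctan).sub (hΩ y))) fun y => ?_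
      have := (hwg y).trans (hgle y)
      rw [show (τ - y) ^ 2 = (y - τ) ^ 2 by ring] at this
      simp only [Pi.zero_apply, one_div, mul_one]
      linarith
    rcases le_total z y with hzy | hzy
    · have h1 := hJ hzy
      simp only at h1
      linarith [Real.arctan_lt_pi_div_two (y - τ), Real.neg_pi_div_two_lt_arctan (z - τ)]
    · have h1 := hmono hzy
      simp only at h1
      linarith [Real.pi_pos]
  · have hs0 : 0 < s := by linarith
    have := Convex.mul_sub_le_image_sub_of_le_deriv (convex_Icc (t - 3 * s - R) (t - 2 * s - R))
      (f := fun y => ∫ r in (0 : ℝ)..y, w r)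
      (fun y _ => (hΩ y).continuousAt.continuousWithinAt)
      (fun y _ => (hΩ y).differentiableAt.differentiableWithinAt) (C := (5 * s) ^ (-b))
      (fun y hy => ?_) (t - 3 * s - R) (left_mem_Icc.2 (by linarith))
      (t - 2 * s - R) (right_mem_Icc.2 (by linarith)) (by linarith)
    · refine le_trans (le_of_eq ?_) this
      rw [Real.mul_rpow (by norm_num) hs0.le, sub_eq_add_neg 1 b, Real.rpow_add hs0,
        Real.rpow_one]
      ring
    · rw [interior_Icc] at hy
      rw [(hΩ y).deriv]
      simp only [hw]
      rw [Real.smoothTransition.one_of_one_le, one_mul]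
      · have h1 : 0 ≤ τ - y := by linarith [hy.2]
        have h2 : τ - y ≤ 4 * s := by linarith [hy.1]
        calc (5 * s) ^ (-b) = ((5 * s) ^ 2) ^ (-b / 2) := by
              rw [← Real.rpow_natCast, ← Real.rpow_mul (by positivity)]
              congr 1
              push_cast
              ring
          _ ≤ g y := Real.rpow_le_rpow_of_nonpos (hpos y) (by nlinarith) (by linarith)
      · rw [one_le_div (by linarith)]
        linarith [hy.1]

namespace IsSolution

variable {n : ℕ} {p R : ℝ} {u : EuclideanSpace ℝ (Fin n) → ℝ → ℝ} (h : IsSolution n p R u)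
include h

/-- A power lower bound for the nonlinear term makes plane wave averages grow logarithmically. -/
lemma exists_log_le_planeWave (hp : 0 < p) (hR : 0 < R) {b q c s₁ : ℝ} (hb : 2 ≤ b)
    (hbq : b = q + 2) (hc : 0 < c) (hlow : ∀ t, s₁ ≤ t → c * t ^ q ≤ ∫ x, |u x t| ^ p) :
    ∃ c' t₁ : ℝ, 0 < c' ∧ ∀ t, t₁ ≤ t → ∃ w : ℝ → ℝ, Continuous w ∧ (∀ y, y < t / 2 → w y = 0) ∧
      (∀ y, y ≤ t + R → |w y| ≤ (t + R + 1 - y) ^ (-b)) ∧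
      ∀ ω : EuclideanSpace ℝ (Fin n), ‖ω‖ = 1 →
        c' * Real.log t ≤ ∫ x, u x t * w (inner ℝ x ω) := by
  set K := ∫ x, (Real.pi * |D u (0, 1) 1 x| + 2 * |u x 1|) with hK
  set s₀ := max s₁ (2 * R + 1) with hs₀
  have hs₀1 : s₁ ≤ s₀ := le_max_left _ _
  have hs₀2 : 2 * R + 1 ≤ s₀ := le_max_right _ _
  have hs₀0 : 0 < s₀ := by linarith
  set d := c * 5 ^ (-b) with hd
  have hd0 : 0 < d := by positivity
  obtain ⟨t₂, ht₂⟩ := eventually_atTop.1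
    (Real.tendsto_log_atTop.eventually_ge_atTop (2 / d * (K + d * Real.log (16 * s₀))))
  refine ⟨d / 4, max (16 * s₀) t₂, by positivity, fun t ht => ?_⟩
  have ht16 : 16 * s₀ ≤ t := (le_max_left _ _).trans ht
  have htl := ht₂ t ((le_max_right _ _).trans ht)
  have ht0 : 0 < t := by linarith
  have ht1 : 1 ≤ t := by linarith
  obtain ⟨Ω, w, w', hΩ, hw, hw', hwz, hwnn, hw1, hwb, hmono, hπ, hinc⟩ :=
    exists_polynomial_profile hb hR ht0
  refine ⟨w, continuous_iff_continuousAt.2 fun y => (hw y).continuousAt, hwz,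
    fun y hy => by rw [abs_of_nonneg (hwnn y)]; exact hwb y hy, fun ω hω => ?_⟩
  have key := h.duhamel hp hΩ hw hw' hω one_pos ht1
  have hdata : |∫ x, (D u (0, 1) 1 x * (Ω (inner ℝ x ω + t - 1) - Ω (inner ℝ x ω - t + 1))
      + u x 1 * (w (inner ℝ x ω + t - 1) + w (inner ℝ x ω - t + 1)))| ≤ K := by
    have i₁ : Integrable (fun x : EuclideanSpace ℝ (Fin n) => D u (0, 1) 1 x) :=
      (h.field_D (0, 1)).integrable one_pos
    have i₂ : Integrable (fun x => u x 1) := h.field.integrable one_pos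
    rw [← Real.norm_eq_abs]
    refine norm_integral_le_of_norm_le ((i₁.abs.const_mul Real.pi).add (i₂.abs.const_mul 2))
      (Eventually.of_forall fun x => ?_)
    rw [Real.norm_eq_abs]
    refine (abs_add_le _ _).trans (add_le_add ?_ ?_)
    · rw [abs_mul, mul_comm]
      gcongr
      rw [abs_of_nonneg (sub_nonneg.2 (hmono (by linarith)))]
      exact hπ _ _
    · rw [abs_mul, mul_comm]
      gcongr
      rw [abs_of_nonneg (add_nonneg (hwnn _) (hwnn _))]
      linarith [hw1 (inner ℝ x ω + t - 1), hw1 (inner ℝ x ω - t + 1)]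
  set Φ : ℝ → EuclideanSpace ℝ (Fin n) → ℝ := fun s x =>
    Ω (inner ℝ x ω + t - s) - Ω (inner ℝ x ω - t + s) with hΦ
  have hΩc : Continuous Ω := continuous_iff_continuousAt.2 fun y => (hΩ y).continuousAt
  have hΦc : Continuous (Function.uncurry Φ) := by
    simp only [hΦ, Function.uncurry_def]
    exact (hΩc.comp (by fun_prop)).sub (hΩc.comp (by fun_prop))
  have hnn : ∀ s, s ≤ t → 0 ≤ ∫ x, |u x s| ^ p * Φ s x := fun s hs =>
    integral_nonneg fun x => mul_nonneg (by positivity) (sub_nonneg.2 (hmono (by linarith)))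
  have hpt : ∀ s ∈ Icc s₀ (t / 16), d * s⁻¹ ≤ ∫ x, |u x s| ^ p * Φ s x := fun s hs => by
    have hs0 : 0 < s := hs₀0.trans_le hs.1
    have hsR : 2 * R + 1 ≤ s := hs₀2.trans hs.1
    have e : 0 ≤ (5 : ℝ) ^ (-b) * s ^ (1 - b) := by positivity
    calc d * s⁻¹ = 5 ^ (-b) * s ^ (1 - b) * (c * s ^ q) := by
          have : s ^ (1 - b) * s ^ q = s⁻¹ := by
            rw [← Real.rpow_add hs0, ← Real.rpow_neg_one, hbq]
            ring_nf
          rw [hd, ← this]; ring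
      _ ≤ 5 ^ (-b) * s ^ (1 - b) * ∫ x, |u x s| ^ p :=
        mul_le_mul_of_nonneg_left (hlow s (hs₀1.trans hs.1)) e
      _ = ∫ x, 5 ^ (-b) * s ^ (1 - b) * |u x s| ^ p := (integral_const_mul _ _).symm
      _ ≤ ∫ x, |u x s| ^ p * Φ s x := by
        refine integral_mono (((h.field.abs_rpow hp).integrable hs0).const_mul _)
          ((h.field_source hp hΦc).integrable hs0) fun x => ?_
        simp only
        rcases lt_or_ge (s + R) ‖x‖ with hx | hx
        · simp [h.supp s hs0 x hx, hp.ne']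
        · rw [mul_comm]
          gcongr
          have h1 := abs_real_inner_le_norm x ω
          rw [hω, mul_one] at h1
          obtain ⟨h2, h3⟩ := abs_le.1 (h1.trans hx)
          refine (hinc s hsR hs.2).trans (sub_le_sub (hmono ?_) (hmono ?_))
          · linarith
          · linarith [hs.2]
  have i : ∀ {a e : ℝ}, 0 < a → 0 < e →
      IntervalIntegrable (fun s => ∫ x, |u x s| ^ p * Φ s x) volume a e :=
    fun ha he => h.intervalIntegrable_source hp hΦc ha he
  have ht16' : s₀ ≤ t / 16 := by linarith
  have ht160 : 0 < t / 16 := by linarith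
  have hlog : d * Real.log (t / 16 / s₀) ≤ ∫ s in s₀..(t / 16), ∫ x, |u x s| ^ p * Φ s x := by
    rw [← integral_inv_of_pos hs₀0 ht160, ← intervalIntegral.integral_const_mul]
    refine intervalIntegral.integral_mono_on ht16' ?_ (i hs₀0 ht160) hpt
    refine (intervalIntegral.intervalIntegrable_inv (fun s hs => ?_) continuousOn_id).const_mul d
    rw [uIcc_of_le ht16'] at hs
    exact (hs₀0.trans_le hs.1).ne'
  have a₁ := intervalIntegral.integral_add_adjacent_intervals (i one_pos hs₀0) (i hs₀0 ht160)
  have a₂ := intervalIntegral.integral_add_adjacent_intervals (i one_pos ht160) (i ht160 ht0)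
  have n₁ : 0 ≤ ∫ s in (1 : ℝ)..s₀, ∫ x, |u x s| ^ p * Φ s x :=
    intervalIntegral.integral_nonneg (by linarith) fun s hs => hnn s (by linarith [hs.2])
  have n₂ : 0 ≤ ∫ s in (t / 16)..t, ∫ x, |u x s| ^ p * Φ s x :=
    intervalIntegral.integral_nonneg (by linarith) fun s hs => hnn s hs.2
  have hl : Real.log (t / 16 / s₀) = Real.log t - Real.log (16 * s₀) := by
    rw [div_div, Real.log_div ht0.ne' (by positivity)]
  rw [hl] at hlog
  have hfin : K + d * Real.log (16 * s₀) ≤ d / 2 * Real.log t := by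
    have := mul_le_mul_of_nonneg_left htl (show 0 ≤ d / 2 by positivity)
    rwa [← mul_assoc, show d / 2 * (2 / d) = 1 by field_simp, one_mul] at this
  have := neg_le_of_abs_le hdata
  linarith

/-- The logarithmically improved lower bound for the nonlinear term. -/
lemma exists_log_le_integral (hn : 2 ≤ n) (hp : 1 < p) (hR : 0 < R) {b q c s₁ : ℝ}
    (hb : 2 ≤ b) (hbq : b = q + 2) (hbp : b = ((n : ℝ) - 1) / 2 + 1 - 1 / p)
    (hq : q = (n : ℝ) - 1 - ((n : ℝ) - 1) * p / 2) (hc : 0 < c)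
    (hlow : ∀ t, s₁ ≤ t → c * t ^ q ≤ ∫ x, |u x t| ^ p) :
    ∃ c' t₁ : ℝ, 0 < c' ∧ ∀ t, t₁ ≤ t → c' * t ^ q * Real.log t ≤ ∫ x, |u x t| ^ p := by
  obtain ⟨c', t₁, hc', hw⟩ := h.exists_log_le_planeWave (by linarith) hR hb hbq hc hlow
  obtain ⟨C, hC, key⟩ := rpow_le_integral_of_planeWave hn hp hR hbp zero_le_one
  refine ⟨c' ^ p / C, max t₁ (2 * R + 2), by positivity, fun t ht => ?_⟩
  have ht₁ : t₁ ≤ t := (le_max_left _ _).trans ht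
  have ht₂ : 2 * R + 2 ≤ t := (le_max_right _ _).trans ht
  have ht0 : 0 < t := by linarith
  have hlog : 0 < Real.log t := Real.log_pos (by linarith)
  obtain ⟨w, hwc, hwz, hwb, hwl⟩ := hw t ht₁
  have := key (fun x => u x t) w t (t / 2) (c' * Real.log t) (h.field.continuous_slice ht0)
    (h.supp t ht0) hwc (by linarith) (by linarith) le_rfl (by positivity)
    (fun ρ hρ => hwz ρ (by linarith)) (fun ρ hρ => by rw [one_mul]; exact hwb ρ hρ)
    (fun ω hω => (hwl ω hω).trans ((le_abs_self _).trans (le_add_of_nonneg_right (abs_nonneg _))))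
  rw [← hq] at this
  have hh : 0 ≤ ∫ x, |u x t| ^ p := integral_nonneg fun x => by positivity
  have hL : Real.log (R + 1 + t / 2) ^ (p - 1) ≤ Real.log t ^ (p - 1) := by
    refine Real.rpow_le_rpow (Real.log_nonneg (by linarith)) ?_ (by linarith)
    exact Real.log_le_log (by linarith) (by linarith)
  have h1 : (c' * Real.log t) ^ p
      ≤ C * (t ^ (-q) * Real.log t ^ (p - 1)) * ∫ x, |u x t| ^ p := this.trans (by gcongr)
  rw [Real.mul_rpow hc'.le hlog.le, Real.rpow_sub_one hlog.ne', Real.rpow_neg ht0.le] at h1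
  have hq0 : 0 < t ^ q := by positivity
  have hl0 : 0 < Real.log t ^ p := by positivity
  rw [div_mul_eq_mul_div, div_mul_eq_mul_div, div_le_iff₀ hC]
  have h2 := mul_le_mul_of_nonneg_right h1 (show 0 ≤ t ^ q * Real.log t / Real.log t ^ p by
    positivity)
  convert h2 using 1 <;> field_simp

end IsSolution

/-- Integrating a lower bound `t ^ a * log t` for a derivative. -/
lemma exists_mul_rpow_mul_log_le {G G' : ℝ → ℝ} {a c t₁ : ℝ} (ha : 0 ≤ a) (hc : 0 < c)
    (hG : ∀ s, 0 < s → HasDerivAt G (G' s) s)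
    (hlow : ∀ s, t₁ ≤ s → c * s ^ a * Real.log s ≤ G' s) :
    ∃ c' t₂ : ℝ, 0 < c' ∧ ∀ t, t₂ ≤ t → c' * t ^ (a + 1) * Real.log t ≤ G t := by
  set T := max t₁ 2 with hT
  have hT1 : t₁ ≤ T := le_max_left _ _
  have hT2 : 2 ≤ T := le_max_right _ _
  obtain ⟨t₃, ht₃⟩ := eventually_atTop.1
    (Real.tendsto_log_atTop.eventually_ge_atTop (4 / c * |G T|))
  refine ⟨c / 4 * (1 / 2) ^ (a + 1), max (2 * T) t₃, by positivity, fun t ht => ?_⟩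
  have htT : 2 * T ≤ t := (le_max_left _ _).trans ht
  have htl := ht₃ t ((le_max_right _ _).trans ht)
  have ht0 : 0 < t / 2 := by linarith
  have mvt : ∀ {x y C : ℝ}, 0 < x → x ≤ y → (∀ s, x < s → C ≤ G' s) → C * (y - x) ≤ G y - G x :=
    fun {x y C} hx hxy hC => Convex.mul_sub_le_image_sub_of_le_deriv (convex_Icc x y)
      (fun s hs => (hG s (hx.trans_le hs.1)).continuousAt.continuousWithinAt)
      (fun s hs => (hG s (hx.trans_le (interior_subset hs).1)).differentiableAt.differentiableWithinAt)
      (fun s hs => by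
        rw [interior_Icc] at hs
        rw [(hG s (hx.trans hs.1)).deriv]
        exact hC s hs.1) x (left_mem_Icc.2 hxy) y (right_mem_Icc.2 hxy) hxy
  have h1 : G T ≤ G (t / 2) := by
    have := mvt (x := T) (y := t / 2) (C := 0) (by linarith) (by linarith) fun s hs => by
      have : 0 ≤ Real.log s := Real.log_nonneg (by linarith)
      have : 0 < s := by linarith
      exact le_trans (by positivity) (hlow s (by linarith))
    linarith
  have hlog2 : Real.log t / 2 ≤ Real.log (t / 2) := by
    rw [div_le_iff₀ two_pos, mul_comm, ← Real.log_rpow ht0]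
    refine Real.log_le_log (by linarith) ?_
    rw [Real.rpow_two]
    nlinarith
  have h2 := mvt (x := t / 2) (y := t) (C := c * (t / 2) ^ a * (Real.log t / 2)) ht0 (by linarith)
    fun s hs => by
      have h3 : Real.log (t / 2) ≤ Real.log s := Real.log_le_log ht0 hs.le
      have h4 : 0 ≤ Real.log (t / 2) := Real.log_nonneg (by linarith)
      have h5 : Real.log t / 2 ≤ Real.log s := hlog2.trans h3
      have h6 : 0 ≤ Real.log t := Real.log_nonneg (by linarith)
      have h7 : 0 < s := ht0.trans hs
      refine le_trans ?_ (hlow s (by linarith))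
      gcongr
  have hpow : (t / 2) ^ a * (t / 2) = (t / 2) ^ (a + 1) := by
    rw [Real.rpow_add_one ht0.ne']
  have hone : 1 ≤ (t / 2) ^ (a + 1) := Real.one_le_rpow (by linarith) (by linarith)
  have habs : |G T| ≤ c / 4 * (t / 2) ^ (a + 1) * Real.log t := by
    have h3 : |G T| ≤ c / 4 * Real.log t := by
      have := mul_le_mul_of_nonneg_left htl (show 0 ≤ c / 4 by positivity)
      rwa [← mul_assoc, show c / 4 * (4 / c) = 1 by field_simp, one_mul] at this
    have := mul_le_mul_of_nonneg_right hone ((abs_nonneg (G T)).trans h3)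
    linarith
  have h7 := neg_abs_le (G T)
  have h8 : c / 4 * (1 / 2) ^ (a + 1) * t ^ (a + 1) * Real.log t
      = c / 4 * (t / 2) ^ (a + 1) * Real.log t := by
    rw [mul_assoc (c / 4), ← Real.mul_rpow (by norm_num) (by linarith)]
    ring_nf
  rw [h8]
  have h9 : c * (t / 2) ^ a * (Real.log t / 2) * (t - t / 2)
      = c / 2 * (t / 2) ^ (a + 1) * Real.log t := by
    rw [← hpow]; ring
  linarith

lemma mul_rpow_mul_log_le_of_le {a C c s t s' t' : ℝ} (ha : 0 ≤ a) (hC : 0 ≤ C) (hCc : C ≤ c)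
    (hs : 0 ≤ s) (hst : s ≤ t) (hs' : 1 ≤ s') (hst' : s' ≤ t') :
    C * s ^ a * Real.log s' ≤ c * t ^ a * Real.log t' := by
  have h1 : 0 ≤ Real.log s' := Real.log_nonneg hs'
  have h2 : Real.log s' ≤ Real.log t' := Real.log_le_log (by linarith) hst'
  have h3 : 0 ≤ c := hC.trans hCc
  have h4 : 0 ≤ t := hs.trans hst
  gcongr

lemma timeSet_top : timeSet ⊤ = Ici 0 := by
  ext t
  simp [timeSet]

section Critical

variable {n : ℕ} {p : ℝ} (hn : 4 ≤ n) (hp : 0 < p)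
  (hpc : ((n : ℝ) - 1) * p ^ 2 - ((n : ℝ) + 1) * p - 2 = 0)
include hn hp hpc

lemma one_lt_of_critical : 1 < p := by
  have : (4 : ℝ) ≤ n := by exact_mod_cast hn
  by_contra! h
  have h1 : 0 ≤ ((n : ℝ) - 1) * (p * (1 - p)) :=
    mul_nonneg (by linarith) (mul_nonneg hp.le (by linarith))
  nlinarith

lemma le_two_of_critical : p ≤ 2 := by
  have : (4 : ℝ) ≤ n := by exact_mod_cast hn
  by_contra! h
  have h1 : 0 < (p - 2) * (((n : ℝ) - 1) * p + (n - 3)) := by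
    have : 0 ≤ ((n : ℝ) - 1) * p := by
      have : 0 ≤ (n : ℝ) - 1 := by linarith
      positivity
    exact mul_pos (by linarith) (by linarith)
  nlinarith

end Critical

namespace IsSolution

variable {n : ℕ} {p R : ℝ} {u : EuclideanSpace ℝ (Fin n) → ℝ → ℝ} (h : IsSolution n p R u)
include h

lemma derivWithin_derivWithin_mass (hn : 0 < n) (hp : 0 < p) {t : ℝ} (ht : 0 < t) :
    derivWithin (derivWithin (fun s : ℝ => ∫ x, u x s) (Ici 0)) (Ici 0) t
      = ∫ x, |u x t| ^ p := by
  rw [derivWithin_of_mem_nhds (Ici_mem_nhds ht)]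
  have : derivWithin (fun s : ℝ => ∫ x, u x s) (Ici 0)
      =ᶠ[nhds t] fun s => ∫ x, D u (0, 1) s x := by
    filter_upwards [Ioi_mem_nhds ht] with s hs
    rw [derivWithin_of_mem_nhds (Ici_mem_nhds hs), (h.hasDerivAt_mass hs).deriv]
  rw [this.deriv_eq, (h.hasDerivAt_deriv_mass hn hp ht).deriv]

lemma exists_lower_bounds (hn : 4 ≤ n) (hp : 0 < p)
    (hpc : ((n : ℝ) - 1) * p ^ 2 - ((n : ℝ) + 1) * p - 2 = 0) (hR : 0 < R)
    (hu : ∃ s, 0 < s ∧ ∃ x, u x s ≠ 0) :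
    ∃ C : ℝ, 0 < C ∧ ∃ t₁ : ℝ, 0 < t₁ ∧ ∀ t : ℝ, t₁ ≤ t →
      (C * (t - R) ^ ((n : ℝ) - 1 - ((n : ℝ) - 1) * p / 2) * Real.log ((t - R) / 2) ≤
          ∫ x, |u x t| ^ p) ∧
      (C * (t - R) ^ ((n : ℝ) + 1 - ((n : ℝ) - 1) * p / 2) * Real.log t ≤ ∫ x, u x t) := by
  have hn' : (4 : ℝ) ≤ n := by exact_mod_cast hn
  have hp1 := one_lt_of_critical hn hp hpc
  have hp2 := le_two_of_critical hn hp hpc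
  set q := (n : ℝ) - 1 - ((n : ℝ) - 1) * p / 2 with hq
  have hq0 : 0 ≤ q := by
    have : 0 ≤ ((n : ℝ) - 1) * (2 - p) := mul_nonneg (by linarith) (by linarith)
    linarith
  have hb : q + 2 = ((n : ℝ) - 1) / 2 + 1 - 1 / p := by
    rw [hq]
    field_simp
    linarith
  have hq2 : (n : ℝ) + 1 - ((n : ℝ) - 1) * p / 2 = q + 1 + 1 := by rw [hq]; ring
  obtain ⟨c₀, s₀, hc₀, h₀⟩ := h.exists_power_le_integral (by omega) hp1 hR (by linarith) hu
  obtain ⟨c₁, s₁, hc₁, h₁⟩ :=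
    h.exists_log_le_integral (by omega) hp1 hR (by linarith) rfl hb hq hc₀ h₀
  obtain ⟨c₂, s₂, hc₂, h₂⟩ := exists_mul_rpow_mul_log_le hq0 hc₁
    (fun s hs => h.hasDerivAt_deriv_mass (by omega) hp hs) h₁
  obtain ⟨c₃, s₃, hc₃, h₃⟩ := exists_mul_rpow_mul_log_le (by linarith) hc₂
    (fun s hs => h.hasDerivAt_mass hs) h₂
  refine ⟨min c₁ c₃, lt_min hc₁ hc₃, max (max s₁ s₃) (R + 2), by positivity, fun t ht => ?_⟩
  have ht₁ : s₁ ≤ t := ((le_max_left _ _).trans (le_max_left _ _)).trans ht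
  have ht₃ : s₃ ≤ t := ((le_max_right _ _).trans (le_max_left _ _)).trans ht
  have htR : R + 2 ≤ t := (le_max_right _ _).trans ht
  rw [hq2]
  have hmin : 0 ≤ min c₁ c₃ := (lt_min hc₁ hc₃).le
  exact ⟨(mul_rpow_mul_log_le_of_le hq0 hmin (min_le_left _ _) (by linarith) (by linarith)
      (by linarith) (by linarith)).trans (h₁ t ht₁),
    (mul_rpow_mul_log_le_of_le (by linarith) hmin (min_le_right _ _) (by linarith) (by linarith)
      (by linarith) le_rfl).trans (h₃ t ht₃)⟩

end IsSolution

/-- A solution vanishing for all positive times has vanishing data. -/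
lemma data_eq_zero_of_forall_pos {n : ℕ} {u : EuclideanSpace ℝ (Fin n) → ℝ → ℝ}
    (hreg : ContinuousOn (fun q : EuclideanSpace ℝ (Fin n) × ℝ => u q.1 q.2) (univ ×ˢ Ici 0))
    (hu : ∀ s, 0 < s → ∀ x, u x s = 0) (x : EuclideanSpace ℝ (Fin n)) :
    u x 0 = 0 ∧ deriv (u x) 0 = 0 := by
  have hEq : u x =ᶠ[nhdsWithin 0 (Ioi 0)] fun _ => 0 :=
    eventually_nhdsWithin_of_forall fun s hs => hu s hs x
  have hc : ContinuousOn (u x) (Ici 0) :=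
    hreg.comp (f := fun s : ℝ => (x, s)) (by fun_prop) fun s hs => ⟨trivial, hs⟩
  have h0 : u x 0 = 0 :=
    tendsto_nhds_unique (((hc 0 self_mem_Ici).mono Ioi_subset_Ici_self).tendsto.congr' hEq)
      tendsto_const_nhds
  refine ⟨h0, ?_⟩
  by_cases hd : DifferentiableAt ℝ (u x) 0
  · have h1 := (hd.hasDerivAt.hasDerivWithinAt (s := Ioi 0)).congr_of_eventuallyEq
      (f₁ := fun _ => 0) hEq.symm h0.symm
    exact (uniqueDiffWithinAt_Ioi 0).eq_deriv _ h1 (hasDerivWithinAt_const _ _ _)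
  · exact deriv_zero_of_not_differentiableAt hd

end CriticalWave

/-- **(2.24) and its consequences:** let `n ≥ 4` and `p = p_c(n)` (the positive root of
`(n-1)p² - (n+1)p - 2 = 0`), with nonnegative initial data one of which is positive
somewhere.  Then there is `C > 0` such that for all sufficiently large `t < T`:
`∫ |u(x,t)|^p dx ≥ C (t-R)^{n-1-(n-1)p/2} ln((t-R)/2)`, hence
`F₀''(t) ≥ C (t-R)^{n-1-(n-1)p/2} ln((t-R)/2)` and
`F₀(t) ≥ C (t-R)^{n+1-(n-1)p/2} ln t`, where `F₀(t) = ∫ u(x,t) dx`. -/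
theorem refined_log_lower_bound
    (n : ℕ) (hn : 4 ≤ n) (p R : ℝ) (T : ℝ≥0∞)
    (hp : 0 < p) (hpc : ((n : ℝ) - 1) * p ^ 2 - ((n : ℝ) + 1) * p - 2 = 0)
    (hR : 0 < R) (hT : 0 < T)
    (u : EuclideanSpace ℝ (Fin n) → ℝ → ℝ) (u₀ u₁ : EuclideanSpace ℝ (Fin n) → ℝ)
    (hu₀ : ∀ x, 0 ≤ u₀ x) (hu₁ : ∀ x, 0 ≤ u₁ x)
    (hpos : (∃ x, 0 < u₀ x) ∨ (∃ x, 0 < u₁ x))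
    (hdata_supp : ∀ x : EuclideanSpace ℝ (Fin n), R < ‖x‖ → u₀ x = 0 ∧ u₁ x = 0)
    (hreg : ContDiffOn ℝ 2 (fun q : EuclideanSpace ℝ (Fin n) × ℝ => u q.1 q.2)
      (Set.univ ×ˢ timeSet T))
    (heq : ∀ x, ∀ t ∈ timeSet T,
      lap n (fun y => u y t) x - iteratedDeriv 2 (u x) t + |u x t| ^ p = 0)
    (hinit₀ : ∀ x, u x 0 = u₀ x)
    (hinit₁ : ∀ x, deriv (u x) 0 = u₁ x)
    (hsupp : ∀ x, ∀ t ∈ timeSet T, t + R < ‖x‖ → u x t = 0 ∧ deriv (u x) t = 0) :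
    ∃ C : ℝ, 0 < C ∧ ∃ t₁ : ℝ, ∀ t : ℝ, t₁ ≤ t → ENNReal.ofReal t < T →
      (C * (t - R) ^ ((n : ℝ) - 1 - ((n : ℝ) - 1) * p / 2) * Real.log ((t - R) / 2) ≤
          ∫ x, |u x t| ^ p) ∧
      (C * (t - R) ^ ((n : ℝ) - 1 - ((n : ℝ) - 1) * p / 2) * Real.log ((t - R) / 2) ≤
          derivWithin (derivWithin (fun s : ℝ => ∫ x, u x s) (timeSet T)) (timeSet T) t) ∧
      (C * (t - R) ^ ((n : ℝ) + 1 - ((n : ℝ) - 1) * p / 2) * Real.log t ≤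
          ∫ x, u x t) := by
  rcases eq_or_ne T ⊤ with rfl | hTtop
  · have hreg' : ContDiffOn ℝ 2 (fun q : EuclideanSpace ℝ (Fin n) × ℝ => u q.1 q.2)
        (univ ×ˢ Ioi 0) :=
      hreg.mono (prod_mono_right (CriticalWave.timeSet_top ▸ Ioi_subset_Ici_self))
    have h : CriticalWave.IsSolution n p R u :=
      { contDiffOn := hreg'
        supp := fun s hs x hx => (hsupp x s (CriticalWave.timeSet_top ▸ hs.le) hx).1
        pde := fun s hs x => by
          have := heq x s (CriticalWave.timeSet_top ▸ hs.le)
          rw [CriticalWave.lap_eq_sum_DD hreg' hs,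
            CriticalWave.iteratedDeriv_time_eq_DD hreg' hs] at this
          linarith }
    have hu : ∃ s, 0 < s ∧ ∃ x, u x s ≠ 0 := by
      by_contra! hcon
      have h0 := CriticalWave.data_eq_zero_of_forall_pos
        (CriticalWave.timeSet_top ▸ hreg.continuousOn) hcon
      rcases hpos with ⟨x, hx⟩ | ⟨x, hx⟩
      · exact hx.ne' ((hinit₀ x).symm.trans (h0 x).1)
      · exact hx.ne' ((hinit₁ x).symm.trans (h0 x).2)
    obtain ⟨C, hC, t₁, ht₁, hlow⟩ := h.exists_lower_bounds hn hp hpc hR hu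
    refine ⟨C, hC, t₁, fun t ht _ => ⟨(hlow t ht).1, ?_, (hlow t ht).2⟩⟩
    rw [CriticalWave.timeSet_top,
      h.derivWithin_derivWithin_mass (by omega) hp (ht₁.trans_le ht)]
    exact (hlow t ht).1
  · refine ⟨1, one_pos, T.toReal, fun t ht hlt => absurd hlt (not_lt.2 ?_)⟩
    exact (ENNReal.ofReal_toReal hTtop).symm.le.trans (ENNReal.ofReal_le_ofReal ht)
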